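/- arXiv:1104.4789 — 7 statements merged into one kernel-verified Lean document; each statement's English description precedes it below -/
import Mathlib

section
/- The unique ℂ-algebra homomorphism ρ : 𝔥 → End_ℂ(R) satisfying ρ(p_n) = ∂_n and ρ(q_n) = X_n for all n ∈ ℕ₊ is injective; that is, the Fock space representation of the Heisenberg algebra on the polynomial ring R is faithful. -/
/-- Generators of the Heisenberg algebra: `Sum.inl n` is `p n`, `Sum.inr n` is `q n`. -/
abbrev HeisGen : Type := ℕ+ ⊕ ℕ+

/-- `p n` as an element of the free algebra. -/
noncomputable def pFree (n : ℕ+) : FreeAlgebra ℂ HeisGen := FreeAlgebra.ι ℂ (Sum.inl n)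

/-- `q n` as an element of the free algebra. -/
noncomputable def qFree (n : ℕ+) : FreeAlgebra ℂ HeisGen := FreeAlgebra.ι ℂ (Sum.inr n)

/-- The defining relations of the Heisenberg algebra:
`p_n q_m = q_m p_n + δ_{n,m} 1`, `p_n p_m = p_m p_n`, `q_n q_m = q_m q_n`. -/
inductive HeisRel : FreeAlgebra ℂ HeisGen → FreeAlgebra ℂ HeisGen → Prop
  | pq (n m : ℕ+) : HeisRel (pFree n * qFree m)
      (qFree m * pFree n + (if n = m then (1 : FreeAlgebra ℂ HeisGen) else 0))
  | pp (n m : ℕ+) : HeisRel (pFree n * pFree m) (pFree m * pFree n)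
  | qq (n m : ℕ+) : HeisRel (qFree n * qFree m) (qFree m * qFree n)

/-- The Heisenberg algebra `𝔥`, the quotient of the free algebra by the two-sided
ideal generated by the Heisenberg relations. -/
abbrev Heis : Type := RingQuot HeisRel

/-- The generator `p n` of `𝔥`. -/
noncomputable def P (n : ℕ+) : Heis := RingQuot.mkAlgHom ℂ HeisRel (pFree n)

/-- The generator `q n` of `𝔥`. -/
noncomputable def Q (n : ℕ+) : Heis := RingQuot.mkAlgHom ℂ HeisRel (qFree n)

open MvPolynomial IsMulCommutative in
/-- Evaluation of a polynomial at a family of pairwise commuting elements of an algebra. -/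
noncomputable def commAeval {A : Type*} [Ring A] [Algebra ℂ A] (g : ℕ+ → A)
    (hg : ∀ n m, g n * g m = g m * g n) : MvPolynomial ℕ+ ℂ →ₐ[ℂ] A :=
  haveI := Algebra.isMulCommutative_adjoin ℂ (s := Set.range g)
    (by rintro _ ⟨n, rfl⟩ _ ⟨m, rfl⟩; exact hg n m)
  (Algebra.adjoin ℂ (Set.range g)).val.comp
    (aeval fun n => (⟨g n, Algebra.subset_adjoin ⟨n, rfl⟩⟩ : Algebra.adjoin ℂ (Set.range g)))

open IsMulCommutative in
theorem commAeval_X {A : Type*} [Ring A] [Algebra ℂ A] (g : ℕ+ → A)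
    (hg : ∀ n m, g n * g m = g m * g n) (n : ℕ+) : commAeval g hg (MvPolynomial.X n) = g n := by
  have := Algebra.isMulCommutative_adjoin ℂ (s := Set.range g)
    (by rintro _ ⟨n, rfl⟩ _ ⟨m, rfl⟩; exact hg n m)
  simp only [commAeval, AlgHom.comp_apply, MvPolynomial.aeval_X]
  rfl

namespace Heis

open MvPolynomial

theorem P_mul_Q (n m : ℕ+) : P n * Q m = Q m * P n + if n = m then 1 else 0 := by
  have h := RingQuot.mkAlgHom_rel ℂ (HeisRel.pq n m)
  simpa [P, Q, apply_ite (RingQuot.mkAlgHom ℂ HeisRel)] using h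

theorem P_mul_comm (n m : ℕ+) : P n * P m = P m * P n := by
  simpa [P] using RingQuot.mkAlgHom_rel ℂ (HeisRel.pp n m)

theorem Q_mul_comm (n m : ℕ+) : Q n * Q m = Q m * Q n := by
  simpa [Q] using RingQuot.mkAlgHom_rel ℂ (HeisRel.qq n m)

theorem adjoin_generators : Algebra.adjoin ℂ (Set.range P ∪ Set.range Q) = ⊤ := by
  rw [← (AlgHom.range_eq_top _).2 (RingQuot.mkAlgHom_surjective ℂ HeisRel),
    ← Algebra.map_top, ← FreeAlgebra.adjoin_range_ι, AlgHom.map_adjoin]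
  congr 1
  rw [← Set.range_comp, ← Set.Sum.elim_range]
  congr 1
  ext (n | n) <;> rfl

/-- Polynomials in the generators `Q n`. -/
noncomputable def polyQ : MvPolynomial ℕ+ ℂ →ₐ[ℂ] Heis := commAeval Q Q_mul_comm

/-- Polynomials in the generators `P n`. -/
noncomputable def polyP : MvPolynomial ℕ+ ℂ →ₐ[ℂ] Heis := commAeval P P_mul_comm

@[simp]
theorem polyQ_X (n : ℕ+) : polyQ (X n) = Q n := commAeval_X _ _ n

@[simp]
theorem polyP_X (n : ℕ+) : polyP (X n) = P n := commAeval_X _ _ n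

theorem P_mul_polyQ (n : ℕ+) (f : MvPolynomial ℕ+ ℂ) :
    P n * polyQ f = polyQ f * P n + polyQ (pderiv n f) := by
  induction f using MvPolynomial.induction_on with
  | C a =>
    rw [← MvPolynomial.algebraMap_eq, AlgHom.commutes, ← Algebra.commutes]
    simp [MvPolynomial.algebraMap_eq]
  | add f g hf hg =>
    simp only [map_add, mul_add, add_mul, hf, hg]
    abel
  | mul_X f m hf =>
    have hX : polyQ (pderiv n (X m)) = if n = m then 1 else 0 := by
      rcases eq_or_ne n m with rfl | h
      · rw [pderiv_X_self, map_one, if_pos rfl]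
      · rw [pderiv_X_of_ne h.symm, map_zero, if_neg h]
    rw [Derivation.leibniz, smul_eq_mul, smul_eq_mul, mul_comm (X m)]
    simp only [map_add, map_mul, hX, polyQ_X]
    rw [← mul_assoc, hf, add_mul, mul_assoc, P_mul_Q, mul_add, ← mul_assoc]
    abel

/-- The normal ordered element with polynomial coefficient `F a` in the `Q n` in front of the
monomial with exponent `a` in the `P n`. -/
noncomputable def normalOrdered : ((ℕ+ →₀ ℕ) →₀ MvPolynomial ℕ+ ℂ) →ₗ[ℂ] Heis :=
  Finsupp.lsum ℂ fun a => (LinearMap.mulRight ℂ (polyP (monomial a 1))).comp polyQ.toLinearMap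

@[simp]
theorem normalOrdered_single (a : ℕ+ →₀ ℕ) (f : MvPolynomial ℕ+ ℂ) :
    normalOrdered (Finsupp.single a f) = polyQ f * polyP (monomial a 1) := by
  simp [normalOrdered]

theorem Q_mul_normalOrdered_mem (n : ℕ+) (F : (ℕ+ →₀ ℕ) →₀ MvPolynomial ℕ+ ℂ) :
    Q n * normalOrdered F ∈ LinearMap.range normalOrdered := by
  induction F using Finsupp.induction_linear with
  | zero => simp
  | add F G hF hG => rw [map_add, mul_add]; exact add_mem hF hG
  | single a f => exact ⟨Finsupp.single a (X n * f), by
    rw [normalOrdered_single, normalOrdered_single, map_mul, polyQ_X, mul_assoc]⟩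

theorem P_mul_normalOrdered_mem (n : ℕ+) (F : (ℕ+ →₀ ℕ) →₀ MvPolynomial ℕ+ ℂ) :
    P n * normalOrdered F ∈ LinearMap.range normalOrdered := by
  induction F using Finsupp.induction_linear with
  | zero => simp
  | add F G hF hG => rw [map_add, mul_add]; exact add_mem hF hG
  | single a f =>
    refine ⟨Finsupp.single (Finsupp.single n 1 + a) f + Finsupp.single a (pderiv n f), ?_⟩
    have h : (monomial (Finsupp.single n 1 + a) 1 : MvPolynomial ℕ+ ℂ) = X n * monomial a 1 := by
      simp [X, monomial_mul]
    rw [map_add, normalOrdered_single, normalOrdered_single, normalOrdered_single, h, map_mul,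
      polyP_X, ← mul_assoc, ← mul_assoc, P_mul_polyQ, add_mul]

theorem normalOrdered_surjective : Function.Surjective normalOrdered := by
  intro x
  have key : ∀ y ∈ LinearMap.range normalOrdered, x * y ∈ LinearMap.range normalOrdered := by
    have hx : x ∈ Algebra.adjoin ℂ (Set.range P ∪ Set.range Q) := by
      rw [adjoin_generators]; exact Algebra.mem_top
    induction hx using Algebra.adjoin_induction with
    | mem x hx =>
      rintro _ ⟨F, rfl⟩
      rcases hx with ⟨n, rfl⟩ | ⟨n, rfl⟩
      exacts [P_mul_normalOrdered_mem n F, Q_mul_normalOrdered_mem n F]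
    | algebraMap c =>
      intro y hy
      rw [← Algebra.smul_def]
      exact Submodule.smul_mem _ c hy
    | add u v _ _ hu hv =>
      intro y hy
      rw [add_mul]
      exact add_mem (hu y hy) (hv y hy)
    | mul u v _ _ hu hv =>
      intro y hy
      rw [mul_assoc]
      exact hu _ (hv y hy)
  simpa using key 1 ⟨Finsupp.single 0 1, by simp⟩

section Representation

variable {ρ : Heis →ₐ[ℂ] Module.End ℂ (MvPolynomial ℕ+ ℂ)}

theorem rho_polyQ_apply (hq : ∀ n : ℕ+, ρ (Q n) = LinearMap.mulLeft ℂ (X n))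
    (f g : MvPolynomial ℕ+ ℂ) : ρ (polyQ f) g = f * g := by
  have h : ρ.comp polyQ = Algebra.lmul ℂ (MvPolynomial ℕ+ ℂ) := by
    ext1 n
    simp only [AlgHom.comp_apply, polyQ_X, hq]
    rfl
  exact LinearMap.congr_fun (AlgHom.congr_fun h f) g

theorem rho_polyP_monomial_apply
    (hp : ∀ n : ℕ+, ρ (P n) = (pderiv (R := ℂ) n).toLinearMap) (a b : ℕ+ →₀ ℕ) :
    ∃ k : ℂ, (k ≠ 0 ↔ a ≤ b) ∧
      ∀ r : ℂ, ρ (polyP (monomial a 1)) (monomial b r) = monomial (b - a) (k * r) := by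
  have hadd : ∀ a a' : ℕ+ →₀ ℕ, ρ (polyP (monomial (a + a') 1)) =
      ρ (polyP (monomial a 1)) * ρ (polyP (monomial a' 1)) := fun a a' => by
    rw [← map_mul, ← map_mul, monomial_mul, one_mul]
  have hcomp : ∀ a a' : ℕ+ →₀ ℕ,
      (∀ b, ∃ k : ℂ, (k ≠ 0 ↔ a ≤ b) ∧
        ∀ r : ℂ, ρ (polyP (monomial a 1)) (monomial b r) = monomial (b - a) (k * r)) →
      (∀ b, ∃ k : ℂ, (k ≠ 0 ↔ a' ≤ b) ∧
        ∀ r : ℂ, ρ (polyP (monomial a' 1)) (monomial b r) = monomial (b - a') (k * r)) →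
      ∀ b, ∃ k : ℂ, (k ≠ 0 ↔ a + a' ≤ b) ∧
        ∀ r : ℂ, ρ (polyP (monomial (a + a') 1)) (monomial b r) =
          monomial (b - (a + a')) (k * r) := by
    intro a a' ha ha' b
    obtain ⟨k', hk', h'⟩ := ha' b
    obtain ⟨k, hk, h⟩ := ha (b - a')
    refine ⟨k * k', ?_, fun r => ?_⟩
    · rw [mul_ne_zero_iff, hk, hk']
      constructor
      · rintro ⟨h₁, h₂⟩
        exact (le_tsub_iff_right h₂).1 h₁
      · intro h₁
        exact ⟨le_tsub_of_add_le_right h₁, le_trans le_add_self h₁⟩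
    · rw [hadd, Module.End.mul_apply, h', h, mul_assoc, add_comm a, tsub_add_eq_tsub_tsub]
  have hzero : ∀ b : ℕ+ →₀ ℕ, ∃ k : ℂ, (k ≠ 0 ↔ (0 : ℕ+ →₀ ℕ) ≤ b) ∧
      ∀ r : ℂ, ρ (polyP (monomial 0 1)) (monomial b r) = monomial (b - 0) (k * r) :=
    fun b => ⟨1, by simp, by simp⟩
  induction a using Finsupp.induction_linear generalizing b with
  | zero => exact hzero b
  | add a a' ha ha' => exact hcomp a a' ha ha' b
  | single n j =>
    induction j generalizing b with
    | zero => simpa using hzero b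
    | succ j ih =>
      rw [Finsupp.single_add]
      refine hcomp _ _ ih (fun b => ⟨b n, ?_, fun r => ?_⟩) b
      · simp [Nat.one_le_iff_ne_zero]
      · change ρ (polyP (X n)) _ = _
        rw [polyP_X, hp, mul_comm]
        exact pderiv_monomial

theorem eq_zero_of_rho_normalOrdered_eq_zero
    (hp : ∀ n : ℕ+, ρ (P n) = (pderiv (R := ℂ) n).toLinearMap)
    (hq : ∀ n : ℕ+, ρ (Q n) = LinearMap.mulLeft ℂ (X n))
    {F : (ℕ+ →₀ ℕ) →₀ MvPolynomial ℕ+ ℂ} (hF : ρ (normalOrdered F) = 0) : F = 0 := by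
  by_contra hne
  obtain ⟨a, ha⟩ := F.support.exists_minimal (Finsupp.support_nonempty_iff.2 hne)
  have happ : ∑ c ∈ F.support, F c * ρ (polyP (monomial c 1)) (monomial a 1) = 0 := by
    have h := LinearMap.congr_fun hF (monomial a 1)
    simpa [normalOrdered, Finsupp.sum, rho_polyQ_apply hq] using h
  rw [Finset.sum_eq_single_of_mem a ha.prop] at happ
  · obtain ⟨k, hk, h⟩ := rho_polyP_monomial_apply hp a a
    have hFa : F a ≠ 0 := Finsupp.mem_support_iff.1 ha.prop
    rw [h, mul_one, mul_eq_zero, monomial_eq_zero] at happ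
    exact happ.elim hFa (hk.2 le_rfl)
  · intro c hc hca
    obtain ⟨k, hk, h⟩ := rho_polyP_monomial_apply hp c a
    have hk0 : k = 0 := by
      by_contra hk0
      exact hca (le_antisymm (hk.1 hk0) (ha.le_of_le hc (hk.1 hk0)))
    simp [h, hk0]

end Representation

end Heis

/-- the (unique) algebra homomorphism `ρ : 𝔥 → End_ℂ(R)` with
`ρ(p n) = ∂_n` and `ρ(q n) = X_n` is injective, i.e. the Fock space representation
on the polynomial ring is faithful. -/
theorem fock_representation_faithful
    (ρ : Heis →ₐ[ℂ] Module.End ℂ (MvPolynomial ℕ+ ℂ))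
    (hp : ∀ n : ℕ+, ρ (P n) = (MvPolynomial.pderiv (R := ℂ) n).toLinearMap)
    (hq : ∀ n : ℕ+, ρ (Q n) = LinearMap.mulLeft ℂ (MvPolynomial.X n)) :
    Function.Injective ρ := by
  refine (injective_iff_map_eq_zero ρ).2 fun x hx => ?_
  obtain ⟨F, rfl⟩ := Heis.normalOrdered_surjective x
  rw [Heis.eq_zero_of_rho_normalOrdered_eq_zero hp hq hx, map_zero]
end

section
/- If W ⊆ R is a nonzero ℂ-linear subspace satisfying ∂_n(W) ⊆ W and X_n(W) ⊆ W for all n ∈ ℕ₊, then W = R. Equivalently, R is a simple module over the Heisenberg algebra 𝔥 acting via p_n ↦ ∂_n and q_n ↦ X_n; that is, the Fock space representation is irreducible. -/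
open MvPolynomial

theorem MvPolynomial.totalDegree_pderiv_lt {σ R : Type*} [CommSemiring R] {f : MvPolynomial σ R}
    (i : σ) (hf : 0 < f.totalDegree) : (pderiv i f).totalDegree < f.totalDegree := by
  rw [totalDegree, Finset.sup_lt_iff hf]
  intro m hm
  rw [mem_support_iff, coeff_pderiv] at hm
  have h := le_totalDegree (mem_support_iff.mpr (left_ne_zero_of_mul hm))
  rw [Finsupp.sum_add_index' (fun _ => rfl) (fun _ _ _ => rfl),
    Finsupp.sum_single_index rfl] at h
  exact h

theorem MvPolynomial.exists_pderiv_ne_zero {σ R : Type*} [CommSemiring R] [NoZeroDivisors R]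
    [CharZero R] {f : MvPolynomial σ R} (hf : f.totalDegree ≠ 0) : ∃ i, pderiv i f ≠ 0 := by
  contrapose! hf
  rw [totalDegree_eq_zero_iff]
  intro m hm i
  by_contra hi
  have hle : Finsupp.single i 1 ≤ m := by
    simpa [Nat.one_le_iff_ne_zero] using hi
  have h := coeff_pderiv (i := i) f (m - Finsupp.single i 1)
  rw [hf i, coeff_zero, tsub_add_cancel_of_le hle, eq_comm, mul_eq_zero] at h
  exact h.elim (mem_support_iff.mp hm) (Nat.cast_add_one_ne_zero _)

/-- A subspace stable under all partial derivatives that contains a nonzero polynomial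
contains `1`. -/
theorem MvPolynomial.one_mem_of_pderiv_mem {σ K : Type*} [Field K] [CharZero K]
    {W : Submodule K (MvPolynomial σ K)} (hD : ∀ i, ∀ f ∈ W, pderiv i f ∈ W)
    {f : MvPolynomial σ K} (hf : f ∈ W) (hf0 : f ≠ 0) : 1 ∈ W := by
  induction hn : f.totalDegree using Nat.strong_induction_on generalizing f with
  | _ n ih =>
    by_cases hdeg : f.totalDegree = 0
    · rw [totalDegree_eq_zero_iff_eq_C] at hdeg
      have hc : coeff 0 f ≠ 0 := fun h => hf0 (by rw [hdeg, h, C_0])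
      have h := W.smul_mem (coeff 0 f)⁻¹ hf
      rwa [hdeg, smul_eq_C_mul, coeff_zero_C, ← C_mul, inv_mul_cancel₀ hc, C_1] at h
    · obtain ⟨i, hi⟩ := exists_pderiv_ne_zero hdeg
      exact ih _ (hn ▸ totalDegree_pderiv_lt i (Nat.pos_of_ne_zero hdeg)) (hD i f hf) hi rfl

/-- A subspace stable under multiplication by all variables that contains `1` is everything. -/
theorem MvPolynomial.eq_top_of_one_mem_of_X_mul_mem {σ R : Type*} [CommSemiring R]
    {W : Submodule R (MvPolynomial σ R)} (hX : ∀ i, ∀ f ∈ W, X i * f ∈ W) (h1 : 1 ∈ W) :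
    W = ⊤ := by
  refine Submodule.eq_top_iff'.mpr fun f => ?_
  induction f using MvPolynomial.induction_on with
  | C a => simpa [smul_eq_C_mul] using W.smul_mem a h1
  | add p q hp hq => exact W.add_mem hp hq
  | mul_X p i hp => exact mul_comm p (X i) ▸ hX i p hp

/-- any nonzero ℂ-subspace of `R = ℂ[x_1, x_2, …]` stable under all the
partial derivatives `∂_n` and all the multiplication operators `X_n` is all of `R`;
i.e. the Fock space representation of the Heisenberg algebra is irreducible. -/
theorem fock_representation_irreducible
    (W : Submodule ℂ (MvPolynomial ℕ+ ℂ)) (hW : W ≠ ⊥)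
    (hD : ∀ n : ℕ+, ∀ f ∈ W, pderiv (R := ℂ) n f ∈ W)
    (hX : ∀ n : ℕ+, ∀ f ∈ W, X n * f ∈ W) :
    W = ⊤ := by
  obtain ⟨f, hf, hf0⟩ := W.exists_mem_ne_zero_of_ne_bot hW
  exact eq_top_of_one_mem_of_X_mul_mem hX (one_mem_of_pderiv_mem hD hf hf0)
end

section
/- Let M be a simple left 𝔥-module containing a nonzero vector v with p_n · v = 0 for all n ∈ ℕ₊. Then M is isomorphic, as an 𝔥-module, to the Fock space 𝓕 = 𝔥/I. In particular, any two simple 𝔥-modules generated by a vacuum vector annihilated by all the p_n are isomorphic (the Stone–von Neumann uniqueness of Fock space). -/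
/-- The left ideal `I` of `𝔥` generated by the `p n`. -/
noncomputable def FockIdeal : Submodule Heis Heis := Submodule.span Heis (Set.range P)

/-- The Fock space `𝓕 = 𝔥 / I` as a left `𝔥`-module. -/
abbrev Fock : Type := Heis ⧸ FockIdeal

namespace MvPolynomial

variable {σ R : Type*} [CommRing R] [IsDomain R] [CharZero R]

/-- A polynomial all of whose partial derivatives vanish is constant. -/
theorem eq_C_of_pderiv_eq_zero {f : MvPolynomial σ R} (h : ∀ i, pderiv i f = 0) :
    f = C (coeff 0 f) := by
  classical
  ext m
  rw [coeff_C]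
  split_ifs with hm
  · rw [hm]
  · obtain ⟨i, hi⟩ := Finsupp.ne_iff.mp (Ne.symm hm)
    have hle : Finsupp.single i 1 ≤ m := by
      simpa [Nat.one_le_iff_ne_zero] using hi
    have hcoeff := congrArg (coeff (m - Finsupp.single i 1)) (h i)
    rw [coeff_pderiv, tsub_add_cancel_of_le hle, coeff_zero] at hcoeff
    exact (mul_eq_zero.mp hcoeff).resolve_right (Nat.cast_add_one_ne_zero _)

/-- A set of polynomials closed under partial derivatives, whose only constant is `0`, has no
nonzero element. -/
theorem eq_zero_of_mem_of_pderiv_mem {S : Set (MvPolynomial σ R)}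
    (hS : ∀ i, ∀ f ∈ S, pderiv i f ∈ S) (hC : ∀ c : R, C c ∈ S → c = 0)
    {f : MvPolynomial σ R} (hf : f ∈ S) : f = 0 := by
  suffices key : ∀ (d : ℕ) (f : MvPolynomial σ R),
      (∀ m : σ →₀ ℕ, d ≤ m.degree → coeff m f = 0) → f ∈ S → f = 0 by
    refine key (f.totalDegree + 1) f (fun m hm => ?_) hf
    exact coeff_eq_zero_of_totalDegree_lt (by simpa [Finsupp.degree_apply] using hm)
  intro d
  induction d with
  | zero => exact fun f h _ => MvPolynomial.ext _ _ fun m => by simp [h m]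
  | succ d ih =>
    intro f h hf
    have hconst : f = C (coeff 0 f) := eq_C_of_pderiv_eq_zero fun i => by
      refine ih _ (fun m hm => ?_) (hS i f hf)
      rw [coeff_pderiv, h _ (by simpa using hm), zero_mul]
    rw [hconst] at hf
    rw [hconst, hC _ hf, C_0]

open scoped IsMulCommutative in
/-- Pairwise commuting elements of an algebra can be substituted for the variables of a
polynomial. -/
theorem exists_algHom_X_eq {σ R A : Type*} [CommRing R] [Ring A] [Algebra R A] {q : σ → A}
    (hq : ∀ i j, q i * q j = q j * q i) :
    ∃ ψ : MvPolynomial σ R →ₐ[R] A, ∀ i, ψ (X i) = q i := by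
  have := Algebra.isMulCommutative_adjoin R (s := Set.range q) (by
    rintro _ ⟨i, rfl⟩ _ ⟨j, rfl⟩
    exact hq i j)
  let q' (i : σ) : Algebra.adjoin R (Set.range q) := ⟨q i, Algebra.subset_adjoin ⟨i, rfl⟩⟩
  let ψ : MvPolynomial σ R →ₐ[R] Algebra.adjoin R (Set.range q) := aeval q'
  exact ⟨(Algebra.adjoin R (Set.range q)).val.comp ψ, fun i => by simp [ψ, q']⟩

end MvPolynomial

theorem P_mul_Q (n m : ℕ+) : P n * Q m = Q m * P n + if n = m then 1 else 0 := by
  have h := RingQuot.mkAlgHom_rel ℂ (HeisRel.pq n m)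
  rw [map_mul, map_add, map_mul] at h
  rw [P, Q, h]
  split_ifs <;> simp

theorem Q_mul_Q (n m : ℕ+) : Q n * Q m = Q m * Q n := by
  simpa [Q] using RingQuot.mkAlgHom_rel ℂ (HeisRel.qq n m)

/-- The homomorphism from the polynomial algebra to `𝔥` sending the variable `X n` to `Q n`. -/
noncomputable def polynomialHom : MvPolynomial ℕ+ ℂ →ₐ[ℂ] Heis :=
  (MvPolynomial.exists_algHom_X_eq Q_mul_Q).choose

@[simp]
theorem polynomialHom_X (n : ℕ+) : polynomialHom (MvPolynomial.X n) = Q n :=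
  (MvPolynomial.exists_algHom_X_eq Q_mul_Q).choose_spec n

/-- Commuting `P n` past a polynomial in the `Q m` differentiates the polynomial. -/
theorem P_mul_polynomialHom (n : ℕ+) (f : MvPolynomial ℕ+ ℂ) :
    P n * polynomialHom f = polynomialHom f * P n + polynomialHom (MvPolynomial.pderiv n f) := by
  induction f using MvPolynomial.induction_on with
  | C c =>
    rw [MvPolynomial.pderiv_C, map_zero, add_zero, ← MvPolynomial.algebraMap_eq, AlgHom.commutes]
    exact (Algebra.commutes c (P n)).symm
  | add f g hf hg =>
    simp only [map_add, mul_add, add_mul, hf, hg]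
    abel
  | mul_X f m hf =>
    have hX : polynomialHom (MvPolynomial.pderiv n (MvPolynomial.X m)) =
        if n = m then 1 else 0 := by
      rcases eq_or_ne n m with rfl | h
      · simp
      · simp [h, MvPolynomial.pderiv_X_of_ne h.symm]
    simp only [MvPolynomial.pderiv_mul, map_add, map_mul, polynomialHom_X, hX]
    rw [← mul_assoc, hf, add_mul, mul_assoc, P_mul_Q, mul_add, mul_assoc]
    abel

/-- Modulo the left ideal generated by the `P n`, every element of `𝔥` is a polynomial
in the `Q n`. -/
theorem exists_sub_polynomialHom_mem (h : Heis) : ∃ f, h - polynomialHom f ∈ FockIdeal := by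
  have mul_gen (x : HeisGen) (f : MvPolynomial ℕ+ ℂ) :
      ∃ g, RingQuot.mkAlgHom ℂ HeisRel (FreeAlgebra.ι ℂ x) * polynomialHom f - polynomialHom g
        ∈ FockIdeal := by
    rcases x with n | n
    · refine ⟨MvPolynomial.pderiv n f, ?_⟩
      change P n * _ - _ ∈ _
      rw [P_mul_polynomialHom, add_sub_cancel_right]
      exact FockIdeal.smul_mem _ (Submodule.subset_span ⟨n, rfl⟩)
    · refine ⟨MvPolynomial.X n * f, ?_⟩
      change Q n * _ - _ ∈ _
      simp
  suffices key : ∀ (a : FreeAlgebra ℂ HeisGen) (f : MvPolynomial ℕ+ ℂ),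
      ∃ g, RingQuot.mkAlgHom ℂ HeisRel a * polynomialHom f - polynomialHom g ∈ FockIdeal by
    obtain ⟨a, rfl⟩ := RingQuot.mkAlgHom_surjective ℂ HeisRel h
    simpa using key a 1
  intro a
  induction a using FreeAlgebra.induction with
  | grade0 c =>
    refine fun f => ⟨c • f, ?_⟩
    simp [Algebra.smul_def]
  | grade1 x => exact mul_gen x
  | mul a b ha hb =>
    intro f
    obtain ⟨g, hg⟩ := hb f
    obtain ⟨k, hk⟩ := ha g
    refine ⟨k, ?_⟩
    convert FockIdeal.add_mem
      (FockIdeal.smul_mem (RingQuot.mkAlgHom ℂ HeisRel a) hg) hk using 1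
    rw [map_mul, smul_eq_mul, mul_sub, mul_assoc]
    abel
  | add a b ha hb =>
    intro f
    obtain ⟨g, hg⟩ := ha f
    obtain ⟨k, hk⟩ := hb f
    refine ⟨g + k, ?_⟩
    convert FockIdeal.add_mem hg hk using 1
    simp only [map_add, add_mul]
    abel

section Vacuum

variable {M : Type*} [AddCommGroup M] [Module Heis M] {v : M}

theorem smul_eq_zero_of_mem_fockIdeal (hp : ∀ n : ℕ+, P n • v = 0) {h : Heis}
    (hh : h ∈ FockIdeal) : h • v = 0 := by
  have hle : FockIdeal ≤ LinearMap.ker (LinearMap.toSpanSingleton Heis M v) := by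
    rw [FockIdeal, Submodule.span_le]
    rintro _ ⟨n, rfl⟩
    simpa using hp n
  simpa using hle hh

theorem eq_zero_of_polynomialHom_smul_eq_zero (hv : v ≠ 0) (hp : ∀ n : ℕ+, P n • v = 0)
    {f : MvPolynomial ℕ+ ℂ} (hf : polynomialHom f • v = 0) : f = 0 := by
  refine MvPolynomial.eq_zero_of_mem_of_pderiv_mem
    (S := {f | polynomialHom f • v = 0}) (fun n f hf => ?_) (fun c hc => ?_) hf
  · have h := congrArg (· • v) (P_mul_polynomialHom n f)
    simp only [add_smul, mul_smul, hp n, show polynomialHom f • v = 0 from hf, smul_zero, zero_add] at h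
    exact h.symm
  · by_contra hne
    have hc' : polynomialHom (MvPolynomial.C c) • v = 0 := hc
    apply hv
    calc v = polynomialHom (MvPolynomial.C c⁻¹ * MvPolynomial.C c) • v := by
          rw [← MvPolynomial.C_mul, inv_mul_cancel₀ hne, MvPolynomial.C_1, map_one, one_smul]
      _ = 0 := by rw [map_mul, mul_smul, hc', smul_zero]

/-- The annihilator of a nonzero vacuum vector is exactly the left ideal generated
by the `P n`. -/
theorem ker_toSpanSingleton_eq_fockIdeal (hv : v ≠ 0) (hp : ∀ n : ℕ+, P n • v = 0) :
    LinearMap.ker (LinearMap.toSpanSingleton Heis M v) = FockIdeal := by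
  ext h
  rw [LinearMap.mem_ker, LinearMap.toSpanSingleton_apply]
  refine ⟨fun hh => ?_, smul_eq_zero_of_mem_fockIdeal hp⟩
  obtain ⟨f, hf⟩ := exists_sub_polynomialHom_mem h
  have hfv := smul_eq_zero_of_mem_fockIdeal hp hf
  rw [sub_smul, hh, zero_sub, neg_eq_zero] at hfv
  simpa [eq_zero_of_polynomialHom_smul_eq_zero hv hp hfv] using hf

end Vacuum

/-- Stone–von Neumann uniqueness of Fock space: any simple `𝔥`-module
containing a nonzero vector annihilated by all the `p n` is isomorphic to the
Fock space `𝓕 = 𝔥/I`. -/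
theorem fock_space_unique
    (M : Type) [AddCommGroup M] [Module Heis M] [IsSimpleModule Heis M]
    (v : M) (hv : v ≠ 0) (hp : ∀ n : ℕ+, P n • v = 0) :
    Nonempty (M ≃ₗ[Heis] Fock) := by
  exact ⟨((Submodule.quotEquivOfEq _ _ (ker_toSpanSingleton_eq_fockIdeal hv hp)).symm.trans
    ((LinearMap.toSpanSingleton Heis M v).quotKerEquivOfSurjective
      (IsSimpleModule.toSpanSingleton_surjective Heis hv))).symm⟩
end

section
/- For all n, m ≥ 1, the elements a_n, b_n ∈ 𝔥′ satisfy the relations of the modified presentation of the Heisenberg algebra: a_n b_m = b_m a_n + b_{m−1} a_{n−1}, a_n a_m = a_m a_n, and b_n b_m = b_m b_n (where b_0 = a_0 = 1). -/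
/-- Nonzero integers, indexing the generators of the rescaled presentation. -/
abbrev NzInt : Type := {z : ℤ // z ≠ 0}

/-- The generator `p_z` in the free algebra. -/
noncomputable def pFree' (z : NzInt) : FreeAlgebra ℂ NzInt := FreeAlgebra.ι ℂ z

/-- The rescaled Heisenberg relations: `p_n p_m = p_m p_n + n δ_{n,-m} 1`. -/
inductive HeisRel' : FreeAlgebra ℂ NzInt → FreeAlgebra ℂ NzInt → Prop
  | comm (n m : NzInt) : HeisRel' (pFree' n * pFree' m)
      (pFree' m * pFree' n
        + ((((n : ℤ) * (if (n : ℤ) = -(m : ℤ) then 1 else 0) : ℤ)) : ℂ) • 1)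

/-- The Heisenberg algebra `𝔥′` in its rescaled presentation. -/
abbrev Heis' : Type := RingQuot HeisRel'

/-- The generator `p_z` of `𝔥′`. -/
noncomputable def P' (z : NzInt) : Heis' := RingQuot.mkAlgHom ℂ HeisRel' (pFree' z)

/-- `p_{m+1} ∈ 𝔥′` for `m : ℕ`. -/
noncomputable def pPos (m : ℕ) : Heis' :=
  P' ⟨((m : ℤ) + 1), by positivity⟩

/-- `p_{-(m+1)} ∈ 𝔥′` for `m : ℕ`. -/
noncomputable def pNeg (m : ℕ) : Heis' :=
  P' ⟨-((m : ℤ) + 1), neg_ne_zero.mpr (by positivity)⟩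

/-- The elements `b_n ∈ 𝔥′`, defined by `b_0 = 1` and
`n·b_n = Σ_{m=1}^n (−1)^{m−1} p_{−m} b_{n−m}`. -/
noncomputable def bEl : ℕ → Heis'
  | 0 => 1
  | n + 1 => (((n : ℂ) + 1))⁻¹ •
      ∑ m ∈ Finset.range (n + 1), ((-1 : ℂ)) ^ m • (pNeg m * bEl (n - m))
decreasing_by omega

/-- The elements `a_n ∈ 𝔥′`, defined by `a_0 = 1` and
`n·a_n = Σ_{m=1}^n p_m a_{n−m}`. -/
noncomputable def aEl : ℕ → Heis'
  | 0 => 1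
  | n + 1 => (((n : ℂ) + 1))⁻¹ •
      ∑ m ∈ Finset.range (n + 1), pPos m * aEl (n - m)
decreasing_by omega

lemma P'_mul (n m : NzInt) :
    P' n * P' m = P' m * P' n
      + ((((n : ℤ) * (if (n : ℤ) = -(m : ℤ) then 1 else 0) : ℤ)) : ℂ) • (1 : Heis') := by
  simpa only [P', map_mul, map_add, map_smul, map_one] using
    RingQuot.mkAlgHom_rel ℂ (HeisRel'.comm n m)

lemma pPos_commute (i j : ℕ) : Commute (pPos i) (pPos j) := by
  have h : ¬ ((i : ℤ) + 1 = -((j : ℤ) + 1)) := by omega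
  unfold Commute SemiconjBy pPos
  rw [P'_mul]
  simp only [h, if_false, mul_zero, Int.cast_zero, zero_smul, add_zero]

lemma pNeg_commute (i j : ℕ) : Commute (pNeg i) (pNeg j) := by
  have h : ¬ (-((i : ℤ) + 1) = -(-((j : ℤ) + 1))) := by omega
  unfold Commute SemiconjBy pNeg
  rw [P'_mul]
  simp only [h, if_false, mul_zero, Int.cast_zero, zero_smul, add_zero]

lemma pPos_mul_pNeg (k j : ℕ) :
    pPos k * pNeg j = pNeg j * pPos k + if j = k then ((k : ℂ) + 1) • (1 : Heis') else 0 := by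
  unfold pPos pNeg
  rw [P'_mul]
  by_cases h : j = k
  · simp [h]
  · have h' : ¬ ((k : ℤ) + 1 = -(-((j : ℤ) + 1))) := by omega
    simp only [h, h', if_false, mul_zero, Int.cast_zero, zero_smul]

/-- The extension of a sequence to integer indices, by zero at negative ones. -/
def extendByZero {A : Type*} [Zero A] (f : ℕ → A) : ℤ → A
  | Int.ofNat n => f n
  | Int.negSucc _ => 0

lemma extendByZero_natCast {A : Type*} [Zero A] (f : ℕ → A) (n : ℕ) : extendByZero f n = f n := rfl

lemma extendByZero_of_neg {A : Type*} [Zero A] (f : ℕ → A) {i : ℤ} (hi : i < 0) :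
    extendByZero f i = 0 := by
  obtain ⟨n, rfl⟩ := Int.eq_negSucc_of_lt_zero hi
  rfl

section NewtonRecursion

variable {A : Type*} [Ring A] [Algebra ℂ A]

/-- The recursion `n f_n = ∑_{m=1}^n q_m f_{n-m}` with `f_0 = 1`, where `q_m` is stored
at index `m - 1`. -/
structure IsNewtonSeq (q f : ℕ → A) : Prop where
  zero : f 0 = 1
  succ (n : ℕ) : f (n + 1) = ((n : ℂ) + 1)⁻¹ • ∑ m ∈ Finset.range (n + 1), q m * f (n - m)

namespace IsNewtonSeq

variable {q f : ℕ → A}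

lemma extendByZero_zero (h : IsNewtonSeq q f) : extendByZero f 0 = 1 := h.zero

lemma smul_extendByZero (h : IsNewtonSeq q f) {i : ℤ} {N : ℕ} (hN : i ≤ N) :
    (i : ℂ) • extendByZero f i = ∑ j ∈ Finset.range N, q j * extendByZero f (i - j - 1) := by
  rcases le_or_gt i 0 with hi | hi
  · rw [Finset.sum_eq_zero fun j _ => by
      rw [extendByZero_of_neg f (by omega), mul_zero]]
    rcases hi.eq_or_lt with rfl | hi
    · simp
    · rw [extendByZero_of_neg f hi, smul_zero]
  · obtain ⟨n, rfl⟩ : ∃ n : ℕ, i = (n + 1 : ℕ) := ⟨(i - 1).toNat, by omega⟩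
    rw [← Finset.sum_subset (Finset.range_subset_range.2 (by omega : n + 1 ≤ N)) fun j _ hj => by
      rw [extendByZero_of_neg f (by rw [Finset.mem_range] at hj; omega), mul_zero]]
    have hn : (n : ℂ) + 1 ≠ 0 := n.cast_add_one_ne_zero
    rw [extendByZero_natCast, h.succ, Int.cast_natCast, Nat.cast_succ, smul_inv_smul₀ hn]
    refine Finset.sum_congr rfl fun j hj => ?_
    rw [Finset.mem_range] at hj
    rw [← extendByZero_natCast f (n - j)]
    congr 2
    omega

lemma commute_of_forall_commute (h : IsNewtonSeq q f) {x : A} (hx : ∀ j, Commute x (q j)) (n : ℕ) :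
    Commute x (f n) := by
  induction n using Nat.strong_induction_on with
  | _ n ih =>
    cases n with
    | zero => rw [h.zero]; exact Commute.one_right x
    | succ n =>
      rw [h.succ]
      exact (Commute.sum_right _ _ _ fun j _ => (hx j).mul_right (ih _ (by omega))).smul_right _

lemma commute (h : IsNewtonSeq q f) (hq : ∀ i j, Commute (q i) (q j)) (n m : ℕ) :
    Commute (f n) (f m) :=
  h.commute_of_forall_commute
    (fun j => (h.commute_of_forall_commute (fun i => hq j i) n).symm) m

lemma mul_extendByZero {p : A} {k : ℕ} {c : ℂ} (h : IsNewtonSeq q f)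
    (hp : ∀ j, p * q j = q j * p + if j = k then (((k : ℂ) + 1) * c) • (1 : A) else 0) (i : ℤ) :
    p * extendByZero f i = extendByZero f i * p + c • extendByZero f (i - k - 1) := by
  rcases lt_or_ge i 0 with hi | hi
  · simp [extendByZero_of_neg f hi, extendByZero_of_neg f (show i - k - 1 < 0 by omega)]
  obtain ⟨n, rfl⟩ := Int.eq_ofNat_of_zero_le hi
  induction n using Nat.strong_induction_on with
  | _ n ih =>
    rcases n.eq_zero_or_pos with rfl | hn
    · simp [h.extendByZero_zero, extendByZero_of_neg f (show -(k : ℤ) - 1 < 0 by omega)]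
    have key (j : ℕ) : p * (q j * extendByZero f (n - j - 1)) =
        q j * extendByZero f (n - j - 1) * p + c • (q j * extendByZero f (n - k - 1 - j - 1))
          + if j = k then (((k : ℂ) + 1) * c) • extendByZero f (n - j - 1) else 0 := by
      have ih' : p * extendByZero f (n - j - 1) =
          extendByZero f (n - j - 1) * p + c • extendByZero f (n - k - 1 - j - 1) := by
        rw [show (n : ℤ) - k - 1 - j - 1 = n - j - 1 - k - 1 by ring]
        rcases lt_or_ge ((n : ℤ) - j - 1) 0 with hj | hj
        · simp [extendByZero_of_neg f hj,
            extendByZero_of_neg f (show (n : ℤ) - j - 1 - k - 1 < 0 by omega)]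
        · obtain ⟨l, hl⟩ := Int.eq_ofNat_of_zero_le hj
          rw [hl]
          exact ih l (by omega) (by omega)
      rw [← mul_assoc, hp, add_mul, mul_assoc, ih', mul_add, mul_smul_comm, mul_assoc]
      split_ifs <;> simp
    have hn' : (n : ℂ) ≠ 0 := by exact_mod_cast hn.ne'
    apply smul_right_injective A hn'
    have hs := h.smul_extendByZero (i := n) (N := n + k + 1) (by omega)
    have hs' := h.smul_extendByZero (i := (n : ℤ) - k - 1) (N := n + k + 1) (by omega)
    rw [Int.cast_natCast] at hs
    dsimp only
    rw [smul_add, ← mul_smul_comm, ← smul_mul_assoc, hs, Finset.mul_sum,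
      Finset.sum_congr rfl fun j _ => key j, Finset.sum_add_distrib, Finset.sum_add_distrib,
      ← Finset.sum_mul, ← Finset.smul_sum, ← hs',
      Finset.sum_ite_eq' (Finset.range (n + k + 1)), if_pos (Finset.mem_range.2 (by omega)),
      add_assoc, smul_smul, smul_smul, ← add_smul]
    congr 2
    push_cast
    ring

lemma extendByZero_mul {p a b : ℕ → A} (ha : IsNewtonSeq p a) (hb : IsNewtonSeq q b)
    (hpq : ∀ k j, p k * q j =
      q j * p k + if j = k then (((k : ℂ) + 1) * (-1) ^ k) • (1 : A) else 0) (i j : ℤ) :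
    extendByZero a i * extendByZero b j =
      extendByZero b j * extendByZero a i
        + extendByZero b (j - 1) * extendByZero a (i - 1) := by
  rcases lt_or_ge i 0 with hi | hi
  · simp [extendByZero_of_neg a hi, extendByZero_of_neg a (show i - 1 < 0 by omega)]
  obtain ⟨n, rfl⟩ := Int.eq_ofNat_of_zero_le hi
  induction n using Nat.strong_induction_on with
  | _ n ih =>
    rcases n.eq_zero_or_pos with rfl | hn
    · simp [ha.extendByZero_zero, extendByZero_of_neg a (show (-1 : ℤ) < 0 by omega)]
    let c (k : ℕ) : A := (-1 : ℂ) ^ k • (extendByZero b (j - k - 1) * extendByZero a (n - k - 1))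
    have key (k : ℕ) : p k * extendByZero a (n - k - 1) * extendByZero b j =
        extendByZero b j * (p k * extendByZero a (n - k - 1))
          + extendByZero b (j - 1) * (p k * extendByZero a (n - 1 - k - 1))
          + (c k - c (k + 1)) := by
      have ih' : extendByZero a (n - k - 1) * extendByZero b j =
          extendByZero b j * extendByZero a (n - k - 1)
            + extendByZero b (j - 1) * extendByZero a (n - 1 - k - 1) := by
        rw [show (n : ℤ) - 1 - k - 1 = n - k - 1 - 1 by ring]
        rcases lt_or_ge ((n : ℤ) - k - 1) 0 with hk | hk
        · simp [extendByZero_of_neg a hk,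
            extendByZero_of_neg a (show (n : ℤ) - k - 1 - 1 < 0 by omega)]
        · obtain ⟨l, hl⟩ := Int.eq_ofNat_of_zero_le hk
          rw [hl]
          exact ih l (by omega) (by omega)
      rw [mul_assoc, ih', mul_add, ← mul_assoc, ← mul_assoc, hb.mul_extendByZero (hpq k),
        hb.mul_extendByZero (hpq k)]
      simp only [c, add_mul, smul_mul_assoc, mul_assoc, pow_succ, mul_neg, mul_one, neg_smul,
        sub_neg_eq_add, Nat.cast_succ]
      rw [show j - ((k : ℤ) + 1) - 1 = j - 1 - k - 1 by ring,
        show (n : ℤ) - ((k : ℤ) + 1) - 1 = n - 1 - k - 1 by ring]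
      abel
    have hn' : (n : ℂ) ≠ 0 := by exact_mod_cast hn.ne'
    apply smul_right_injective A hn'
    have hs := ha.smul_extendByZero (i := n) (N := n) le_rfl
    have hs' := ha.smul_extendByZero (i := (n : ℤ) - 1) (N := n) (by omega)
    have hc : c n = 0 := by
      simp only [c]
      rw [extendByZero_of_neg a (by omega), mul_zero, smul_zero]
    rw [Int.cast_natCast] at hs
    dsimp only
    rw [smul_add, ← smul_mul_assoc, ← mul_smul_comm, hs, Finset.sum_mul,
      Finset.sum_congr rfl fun k _ => key k, Finset.sum_add_distrib, Finset.sum_add_distrib,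
      ← Finset.mul_sum, ← Finset.mul_sum, ← hs', Finset.sum_range_sub', hc, sub_zero, add_assoc]
    congr 1
    simp only [c, pow_zero, one_smul, Nat.cast_zero, sub_zero, mul_smul_comm]
    push_cast
    rw [sub_smul, one_smul, sub_add_cancel]

end IsNewtonSeq

end NewtonRecursion

lemma isNewtonSeq_aEl : IsNewtonSeq pPos aEl where
  zero := by rw [aEl]
  succ n := by rw [aEl]

lemma isNewtonSeq_bEl : IsNewtonSeq (fun m => (-1 : ℂ) ^ m • pNeg m) bEl where
  zero := by rw [bEl]
  succ n := by simp only [bEl, smul_mul_assoc]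

/-- the elements `a_n, b_n` of `𝔥′` satisfy the relations of the modified
presentation of the Heisenberg algebra:
`a_n b_m = b_m a_n + b_{m−1} a_{n−1}`, `a_n a_m = a_m a_n`, `b_n b_m = b_m b_n`. -/
theorem modified_heisenberg_relations (n m : ℕ) (hn : 1 ≤ n) (hm : 1 ≤ m) :
    aEl n * bEl m = bEl m * aEl n + bEl (m - 1) * aEl (n - 1)
    ∧ aEl n * aEl m = aEl m * aEl n
    ∧ bEl n * bEl m = bEl m * bEl n := by
  refine ⟨?_, isNewtonSeq_aEl.commute pPos_commute n m,
    isNewtonSeq_bEl.commute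
      (fun i j => ((pNeg_commute i j).smul_left _).smul_right _) n m⟩
  have h := isNewtonSeq_aEl.extendByZero_mul isNewtonSeq_bEl (fun k j => by
    rw [mul_smul_comm, pPos_mul_pNeg, smul_add, smul_mul_assoc]
    split_ifs with hjk
    · rw [hjk, smul_smul, mul_comm ((-1 : ℂ) ^ k)]
    · rw [smul_zero]) n m
  rwa [← Nat.cast_pred hn, ← Nat.cast_pred hm] at h
end

section
/- For all n, m ≥ 0, in 𝔥_t one has b^{(n)} a^{(m)} = Σ_{k=0}^{min(n,m)} [k+1] a^{(m−k)} b^{(n−k)}, and moreover a^{(n)} a^{(m)} = a^{(m)} a^{(n)} and b^{(n)} b^{(m)} = b^{(m)} b^{(n)}. (This is the single-node case of the relations among the generators a_i^{(n)}, b_i^{(n)} of the quantum Heisenberg algebra.) -/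
/-- The base field `ℂ(t)` of rational functions. -/
abbrev Kt : Type := RatFunc ℂ

/-- The quantum integer `[k] = t^{−k+1} + t^{−k+3} + ⋯ + t^{k−1}` in `ℂ(t)`. -/
noncomputable def qInt (k : ℕ) : Kt :=
  ∑ i ∈ Finset.range k, (RatFunc.X : Kt) ^ (2 * (i : ℤ) - ((k : ℤ) - 1))

/-- The quantum integer `[z]` for `z : ℤ`, with `[−k] = −[k]`. -/
noncomputable def qIntZ (z : ℤ) : Kt :=
  if 0 ≤ z then qInt z.toNat else -qInt (-z).toNat

/-- The generator `p_z` in the free algebra over `ℂ(t)`. -/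
noncomputable def pFreeQ (z : NzInt) : FreeAlgebra Kt NzInt := FreeAlgebra.ι Kt z

/-- The defining relations of the quantum Heisenberg algebra attached to a single node
`i` with `⟨i,i⟩ = 2`:  `p_n p_m = p_m p_n − δ_{n,−m}·([2n][n]/n)·1`. -/
inductive QHeisRel : FreeAlgebra Kt NzInt → FreeAlgebra Kt NzInt → Prop
  | comm (n m : NzInt) : QHeisRel (pFreeQ n * pFreeQ m)
      (pFreeQ m * pFreeQ n
        - (if (n : ℤ) = -(m : ℤ) then
            qIntZ (2 * (n : ℤ)) * qIntZ (n : ℤ) / (((n : ℤ) : Kt)) else 0) • 1)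

/-- The quantum Heisenberg algebra `𝔥_t` (single node). -/
abbrev QHeis : Type := RingQuot QHeisRel

/-- The generator `p_z` of `𝔥_t`. -/
noncomputable def PQ (z : NzInt) : QHeis := RingQuot.mkAlgHom Kt QHeisRel (pFreeQ z)

/-- `p_{m+1} ∈ 𝔥_t` for `m : ℕ`. -/
noncomputable def pPosQ (m : ℕ) : QHeis := PQ ⟨((m : ℤ) + 1), by positivity⟩

/-- `p_{-(m+1)} ∈ 𝔥_t` for `m : ℕ`. -/
noncomputable def pNegQ (m : ℕ) : QHeis := PQ ⟨-((m : ℤ) + 1), neg_ne_zero.mpr (by positivity)⟩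

/-- The elements `b^{(n)} ∈ 𝔥_t`, defined by `b^{(0)} = 1` and
`n·b^{(n)} = Σ_{m=1}^n (m/[m]) p_{−m} b^{(n−m)}`. -/
noncomputable def bElQ : ℕ → QHeis
  | 0 => 1
  | n + 1 => ((((n : ℕ) + 1 : ℕ) : Kt))⁻¹ •
      ∑ m ∈ Finset.range (n + 1),
        ((((m + 1 : ℕ) : Kt)) / qInt (m + 1)) • (pNegQ m * bElQ (n - m))
decreasing_by omega

/-- The elements `a^{(n)} ∈ 𝔥_t`, defined by `a^{(0)} = 1` and
`n·a^{(n)} = Σ_{m=1}^n (m/[m]) p_m a^{(n−m)}`. -/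
noncomputable def aElQ : ℕ → QHeis
  | 0 => 1
  | n + 1 => ((((n : ℕ) + 1 : ℕ) : Kt))⁻¹ •
      ∑ m ∈ Finset.range (n + 1),
        ((((m + 1 : ℕ) : Kt)) / qInt (m + 1)) • (pPosQ m * aElQ (n - m))
decreasing_by omega

open Finset

section QuantumIntegers

theorem RatFunc.X_pow_ne_one {m : ℕ} (hm : m ≠ 0) : (RatFunc.X : Kt) ^ m ≠ 1 := by
  intro h
  have h' : algebraMap (Polynomial ℂ) Kt (Polynomial.X ^ m) = algebraMap (Polynomial ℂ) Kt 1 := by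
    simpa using h
  have h'' := congrArg Polynomial.natDegree (RatFunc.algebraMap_injective ℂ h')
  simp at h''
  exact hm h''

theorem RatFunc.X_zpow_sub_zpow_neg_ne_zero {m : ℕ} (hm : m ≠ 0) :
    (RatFunc.X : Kt) ^ (m : ℤ) - RatFunc.X ^ (-(m : ℤ)) ≠ 0 := by
  intro h
  have hX : (RatFunc.X : Kt) ≠ 0 := RatFunc.X_ne_zero
  apply RatFunc.X_pow_ne_one (m := m + m) (by omega)
  have h' := sub_eq_zero.mp h
  rw [zpow_neg, zpow_natCast] at h'
  rw [pow_add]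
  nth_rewrite 1 [h']
  exact inv_mul_cancel₀ (pow_ne_zero _ hX)

/-- The closed form `(t - t⁻¹) [k] = t^k - t^{-k}`. -/
theorem X_sub_inv_mul_qInt (k : ℕ) :
    ((RatFunc.X : Kt) - RatFunc.X⁻¹) * qInt k
      = RatFunc.X ^ (k : ℤ) - RatFunc.X ^ (-(k : ℤ)) := by
  have hX : (RatFunc.X : Kt) ≠ 0 := RatFunc.X_ne_zero
  have h : ∀ i ∈ range k, ((RatFunc.X : Kt) - RatFunc.X⁻¹) *
      RatFunc.X ^ (2 * (i : ℤ) - ((k : ℤ) - 1)) =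
      RatFunc.X ^ (2 * ((i + 1 : ℕ) : ℤ) - k) - RatFunc.X ^ (2 * (i : ℤ) - k) := by
    intro i _
    rw [sub_mul, ← zpow_one_add₀ hX, ← zpow_neg_one, ← zpow_add₀ hX]
    congr 2 <;> push_cast <;> ring
  rw [qInt, mul_sum, sum_congr rfl h,
    sum_range_sub (fun i : ℕ => (RatFunc.X : Kt) ^ (2 * (i : ℤ) - k))]
  congr 2 <;> push_cast <;> ring

theorem X_sub_inv_ne_zero : (RatFunc.X : Kt) - RatFunc.X⁻¹ ≠ 0 := by
  simpa using RatFunc.X_zpow_sub_zpow_neg_ne_zero one_ne_zero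

theorem qInt_ne_zero {m : ℕ} (hm : m ≠ 0) : qInt m ≠ 0 := by
  intro h
  have := X_sub_inv_mul_qInt m
  rw [h, mul_zero] at this
  exact RatFunc.X_zpow_sub_zpow_neg_ne_zero hm this.symm

theorem qInt_two_mul (m : ℕ) :
    qInt (2 * m) = (RatFunc.X ^ (m : ℤ) + RatFunc.X ^ (-(m : ℤ))) * qInt m := by
  have hX : (RatFunc.X : Kt) ≠ 0 := RatFunc.X_ne_zero
  apply mul_left_cancel₀ X_sub_inv_ne_zero
  rw [mul_left_comm, X_sub_inv_mul_qInt, X_sub_inv_mul_qInt, add_mul, mul_sub, mul_sub,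
    ← zpow_add₀ hX, ← zpow_add₀ hX, ← zpow_add₀ hX, ← zpow_add₀ hX, neg_add_cancel,
    add_neg_cancel]
  push_cast
  ring_nf

theorem qInt_eq_sum_reflect (k : ℕ) :
    qInt k = ∑ i ∈ range k, (RatFunc.X : Kt) ^ (((k : ℤ) - 1) - 2 * (i : ℤ)) := by
  rw [qInt, ← sum_range_reflect]
  refine sum_congr rfl fun i hi => ?_
  have := mem_range.mp hi
  congr 1
  omega

/-- `∑_{m=1}^{s} (t^m + t^{-m}) [s-m+1] = s [s+1]`. -/
theorem sum_zpow_add_zpow_neg_mul_qInt (s : ℕ) :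
    ∑ i ∈ range s, ((RatFunc.X : Kt) ^ ((i + 1 : ℕ) : ℤ) + RatFunc.X ^ (-((i + 1 : ℕ) : ℤ))) *
      qInt (s - i) = s * qInt (s + 1) := by
  have hX : (RatFunc.X : Kt) ≠ 0 := RatFunc.X_ne_zero
  apply mul_left_cancel₀ X_sub_inv_ne_zero
  have h : ∀ i ∈ range s, ((RatFunc.X : Kt) - RatFunc.X⁻¹) *
      ((RatFunc.X ^ ((i + 1 : ℕ) : ℤ) + RatFunc.X ^ (-((i + 1 : ℕ) : ℤ))) * qInt (s - i)) =
      (RatFunc.X ^ ((s + 1 : ℕ) : ℤ) - RatFunc.X ^ (-((s + 1 : ℕ) : ℤ))) +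
      (RatFunc.X ^ (((s : ℤ) - 1) - 2 * (i : ℤ)) - RatFunc.X ^ (2 * (i : ℤ) - ((s : ℤ) - 1))) := by
    intro i hi
    have hi := mem_range.mp hi
    rw [mul_left_comm, X_sub_inv_mul_qInt, add_mul, mul_sub, mul_sub,
      ← zpow_add₀ hX, ← zpow_add₀ hX, ← zpow_add₀ hX, ← zpow_add₀ hX]
    rw [show ((i + 1 : ℕ) : ℤ) + ((s - i : ℕ) : ℤ) = ((s + 1 : ℕ) : ℤ) by omega,
      show ((i + 1 : ℕ) : ℤ) + -((s - i : ℕ) : ℤ) = 2 * (i : ℤ) - ((s : ℤ) - 1) by omega,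
      show -((i + 1 : ℕ) : ℤ) + ((s - i : ℕ) : ℤ) = ((s : ℤ) - 1) - 2 * (i : ℤ) by omega,
      show -((i + 1 : ℕ) : ℤ) + -((s - i : ℕ) : ℤ) = -((s + 1 : ℕ) : ℤ) by omega]
    ring
  rw [mul_sum, sum_congr rfl h, sum_add_distrib,
    sum_sub_distrib (fun i : ℕ => (RatFunc.X : Kt) ^ (((s : ℤ) - 1) - 2 * (i : ℤ))),
    ← qInt_eq_sum_reflect, ← qInt, sub_self, add_zero, sum_const, card_range,
    mul_left_comm, X_sub_inv_mul_qInt, nsmul_eq_mul]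

theorem sum_antidiagonal_mul_qInt (s : ℕ) :
    ∑ x ∈ antidiagonal s, ((x.1 : Kt) / qInt x.1) * (qInt (2 * x.1) / x.1) * qInt (x.2 + 1)
      = s * qInt (s + 1) := by
  cases s with
  | zero => simp
  | succ n =>
    rw [← sum_zpow_add_zpow_neg_mul_qInt, Nat.sum_antidiagonal_succ,
      Nat.sum_antidiagonal_eq_sum_range_succ_mk]
    simp only [Nat.cast_zero, zero_div, zero_mul, zero_add]
    refine sum_congr rfl fun i hi => ?_
    have hi := mem_range.mp hi
    have h1 : qInt (i + 1) ≠ 0 := qInt_ne_zero (by omega)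
    have h2 : ((i + 1 : ℕ) : Kt) ≠ 0 := by exact_mod_cast Nat.succ_ne_zero i
    rw [qInt_two_mul, show n - i + 1 = n + 1 - i by omega]
    field_simp

end QuantumIntegers

section ShiftedSequences

variable {K R : Type*} [Field K] [Ring R] [Algebra K R]

/-- The sequence entry `a (n - k)`, with the convention that it vanishes when `n < k`. -/
def shiftEntry (a : ℕ → R) (n k : ℕ) : R := if k ≤ n then a (n - k) else 0

theorem sum_shiftEntry {a p : ℕ → R} {c : ℕ → K}
    (ha : ∀ n : ℕ, (n : K) • a n = ∑ x ∈ antidiagonal n, c x.1 • (p x.1 * a x.2)) (n m : ℕ) :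
    ∑ x ∈ antidiagonal n, c x.1 • (p x.1 * shiftEntry a x.2 m)
      = ((n : K) - m) • shiftEntry a n m := by
  by_cases hm : m ≤ n
  · obtain ⟨r, rfl⟩ := Nat.exists_eq_add_of_le hm
    have h := ha r
    rw [Nat.sum_antidiagonal_eq_sum_range_succ_mk] at h ⊢
    simp only [shiftEntry, hm, if_true, Nat.add_sub_cancel_left, Nat.cast_add, add_sub_cancel_left]
    rw [h]
    symm
    refine sum_subset_zero_on_sdiff (range_subset_range.mpr (by omega)) ?_ ?_
    · intro i hi
      simp only [mem_sdiff, mem_range] at hi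
      rw [if_neg (by omega)]
      simp
    · intro i hi
      have hi := mem_range.mp hi
      rw [if_pos (by omega), show m + r - i - m = r - i by omega]
  · rw [shiftEntry, if_neg hm, smul_zero]
    refine sum_eq_zero fun x hx => ?_
    have := mem_antidiagonal.mp hx
    rw [shiftEntry, if_neg (by omega)]
    simp

/-- If `q` commutes with every `p j` except `p m`, up to scalars, then its commutator with the
sequence `a` generated by `p` shifts the sequence by `m`. -/
theorem mul_eq_mul_add_shiftEntry [CharZero K] {a p : ℕ → R} {c : ℕ → K} {q : R} {d e : K} {m : ℕ}
    (h0 : a 0 = 1) (hc : c 0 = 0) (hm : m ≠ 0)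
    (ha : ∀ n : ℕ, (n : K) • a n = ∑ x ∈ antidiagonal n, c x.1 • (p x.1 * a x.2))
    (hq : ∀ j, q * p j = p j * q + (if j = m then e else 0) • 1)
    (hde : c m * e = m * d) (n : ℕ) :
    q * a n = a n * q + d • shiftEntry a n m := by
  induction n using Nat.strong_induction_on with
  | _ n ih =>
  rcases Nat.eq_zero_or_pos n with rfl | hn
  · simp [h0, shiftEntry, hm]
  have hn' : (n : K) ≠ 0 := by exact_mod_cast hn.ne'
  apply (IsUnit.mk0 _ hn').smul_left_cancel.mp
  have step : ∀ x ∈ antidiagonal n, q * (c x.1 • (p x.1 * a x.2)) =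
      (c x.1 • (p x.1 * a x.2)) * q + d • (c x.1 • (p x.1 * shiftEntry a x.2 m))
        + (if x.1 = m then c m * e else 0) • a x.2 := by
    rintro ⟨j, l⟩ hx
    have hx := mem_antidiagonal.mp hx
    dsimp only at hx ⊢
    rcases Nat.eq_zero_or_pos j with rfl | hj
    · simp [hc, hm.symm]
    rw [mul_smul_comm, ← mul_assoc, hq, add_mul, mul_assoc, ih l (by omega)]
    split_ifs with h
    · subst h
      simp only [mul_add, smul_add, smul_mul_assoc, mul_smul_comm, one_mul, smul_smul, mul_assoc,
        mul_comm d]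
    · simp only [mul_add, smul_add, smul_mul_assoc, mul_smul_comm, smul_smul, mul_assoc,
        mul_comm d, zero_smul, zero_mul, add_zero]
  have last : ∑ x ∈ antidiagonal n, (if x.1 = m then c m * e else 0) • a x.2
      = (c m * e) • shiftEntry a n m := by
    rw [Nat.sum_antidiagonal_eq_sum_range_succ_mk]
    simp only [ite_smul, zero_smul, sum_ite_eq', mem_range, shiftEntry, Nat.lt_succ_iff]
    split_ifs <;> simp
  rw [← mul_smul_comm, ha, mul_sum, sum_congr rfl step, sum_add_distrib, sum_add_distrib, last,
    ← sum_mul, ← ha, ← smul_sum, sum_shiftEntry ha, hde, smul_add, smul_mul_assoc, add_assoc,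
    smul_smul, smul_smul, ← add_smul]
  congr 2
  ring

/-- Normal ordering of two sequences generated by families that commute up to shifts. -/
theorem mul_eq_sum_shiftEntry [CharZero K] {a b q : ℕ → R} {c d w : ℕ → K}
    (h0 : b 0 = 1) (hc : c 0 = 0) (hw0 : w 0 = 1)
    (hb : ∀ n : ℕ, (n : K) • b n = ∑ x ∈ antidiagonal n, c x.1 • (q x.1 * b x.2))
    (hq : ∀ m ≠ 0, ∀ n, q m * a n = a n * q m + d m • shiftEntry a n m)
    (hw : ∀ s, ∑ x ∈ antidiagonal s, c x.1 * d x.1 * w x.2 = s * w s) (n M : ℕ) :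
    b n * a M = ∑ x ∈ antidiagonal n, w x.1 • (shiftEntry a M x.1 * b x.2) := by
  have hshift : ∀ m ≠ 0, ∀ k, q m * shiftEntry a M k
      = shiftEntry a M k * q m + d m • shiftEntry a M (m + k) := by
    intro m hm k
    unfold shiftEntry
    by_cases hk : k ≤ M
    · rw [if_pos hk, hq m hm, shiftEntry]
      congr 2
      by_cases h : m + k ≤ M
      · rw [if_pos h, if_pos (by omega), show M - k - m = M - (m + k) by omega]
      · rw [if_neg h, if_neg (by omega)]
    · rw [if_neg hk, if_neg (by omega)]
      simp
  induction n using Nat.strong_induction_on with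
  | _ n ih =>
  rcases Nat.eq_zero_or_pos n with rfl | hn
  · simp [h0, shiftEntry, hw0]
  have hn' : (n : K) ≠ 0 := by exact_mod_cast hn.ne'
  apply (IsUnit.mk0 _ hn').smul_left_cancel.mp
  have step : ∀ x ∈ antidiagonal n, c x.1 • (q x.1 * b x.2) * a M =
      ∑ y ∈ antidiagonal x.2, w y.1 • (shiftEntry a M y.1 * (c x.1 • (q x.1 * b y.2)))
      + ∑ y ∈ antidiagonal x.2,
          (c x.1 * d x.1 * w y.1) • (shiftEntry a M (x.1 + y.1) * b y.2) := by
    rintro ⟨m, l⟩ hx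
    have hx := mem_antidiagonal.mp hx
    dsimp only at hx ⊢
    rcases Nat.eq_zero_or_pos m with rfl | hm
    · simp [hc]
    rw [smul_mul_assoc, mul_assoc, ih l (by omega), mul_sum, smul_sum, ← sum_add_distrib]
    refine sum_congr rfl fun y _ => ?_
    rw [mul_smul_comm, ← mul_assoc, hshift m hm.ne']
    simp only [add_mul, smul_add, smul_mul_assoc, mul_smul_comm, smul_smul, mul_assoc]
    congr 2 <;> ring
  have first : ∑ x ∈ antidiagonal n, ∑ y ∈ antidiagonal x.2,
      w y.1 • (shiftEntry a M y.1 * (c x.1 • (q x.1 * b y.2)))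
      = ∑ x ∈ antidiagonal n, (x.2 * w x.1) • (shiftEntry a M x.1 * b x.2) := by
    have h : ∀ x ∈ antidiagonal n, (x.2 * w x.1) • (shiftEntry a M x.1 * b x.2)
        = ∑ y ∈ antidiagonal x.2, w x.1 • (shiftEntry a M x.1 * (c y.1 • (q y.1 * b y.2))) := by
      intro x _
      rw [← smul_sum, ← mul_sum, ← hb, mul_smul_comm, smul_smul, mul_comm]
    rw [sum_congr rfl h, sum_sigma', sum_sigma']
    refine sum_nbij' (fun x => ⟨(x.2.1, x.1.1 + x.2.2), (x.1.1, x.2.2)⟩)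
      (fun x => ⟨(x.2.1, x.1.1 + x.2.2), (x.1.1, x.2.2)⟩) ?_ ?_ ?_ ?_ ?_
    all_goals
      rintro ⟨⟨i, l⟩, ⟨k, j⟩⟩ hx
      simp only [mem_sigma, HasAntidiagonal.mem_antidiagonal] at hx ⊢
    · exact ⟨by omega, trivial⟩
    · exact ⟨by omega, trivial⟩
    · rw [hx.2]
    · rw [hx.2]
  have second : ∑ x ∈ antidiagonal n, ∑ y ∈ antidiagonal x.2,
      (c x.1 * d x.1 * w y.1) • (shiftEntry a M (x.1 + y.1) * b y.2)
      = ∑ x ∈ antidiagonal n, (x.1 * w x.1) • (shiftEntry a M x.1 * b x.2) := by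
    have h : ∀ x ∈ antidiagonal n, (x.1 * w x.1) • (shiftEntry a M x.1 * b x.2)
        = ∑ y ∈ antidiagonal x.1,
          (c y.1 * d y.1 * w y.2) • (shiftEntry a M (y.1 + y.2) * b x.2) := by
      intro x _
      rw [← hw, sum_smul]
      refine sum_congr rfl fun y hy => ?_
      rw [mem_antidiagonal.mp hy]
    rw [sum_congr rfl h, sum_sigma', sum_sigma']
    refine sum_nbij' (fun x => ⟨(x.1.1 + x.2.1, x.2.2), (x.1.1, x.2.1)⟩)
      (fun x => ⟨(x.2.1, x.2.2 + x.1.2), (x.2.2, x.1.2)⟩) ?_ ?_ ?_ ?_ ?_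
    all_goals
      rintro ⟨⟨i, l⟩, ⟨k, j⟩⟩ hx
      simp only [mem_sigma, HasAntidiagonal.mem_antidiagonal] at hx ⊢
    · exact ⟨by omega, trivial⟩
    · exact ⟨by omega, trivial⟩
    · rw [hx.2]
    · rw [hx.2]
  rw [← smul_mul_assoc, hb, sum_mul, sum_congr rfl step, sum_add_distrib, first, second,
    ← sum_add_distrib, smul_sum]
  refine sum_congr rfl fun x hx => ?_
  have hx := mem_antidiagonal.mp hx
  rw [← add_smul, smul_smul, ← hx]
  congr 1
  push_cast
  ring

theorem commute_of_recursion [CharZero K] {a p : ℕ → R} {c : ℕ → K} {x : R}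
    (h0 : a 0 = 1) (hc : c 0 = 0)
    (ha : ∀ n : ℕ, (n : K) • a n = ∑ x ∈ antidiagonal n, c x.1 • (p x.1 * a x.2))
    (hx : ∀ j, Commute x (p j)) (n : ℕ) : Commute x (a n) := by
  induction n using Nat.strong_induction_on with
  | _ n ih =>
  rcases Nat.eq_zero_or_pos n with rfl | hn
  · rw [h0]
    exact Commute.one_right x
  have hn' : (n : K) ≠ 0 := by exact_mod_cast hn.ne'
  have key : Commute x ((n : K) • a n) := by
    rw [ha]
    refine Commute.sum_right _ _ _ fun y hy => ?_
    have hy := mem_antidiagonal.mp hy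
    rcases Nat.eq_zero_or_pos y.1 with h | h
    · simp [h, hc]
    · exact ((hx _).mul_right (ih _ (by omega))).smul_right _
  simpa [smul_smul, inv_mul_cancel₀ hn'] using key.smul_right (n : K)⁻¹

end ShiftedSequences

section Heisenberg

theorem PQ_mul_PQ (n m : NzInt) : PQ n * PQ m = PQ m * PQ n
    - (if (n : ℤ) = -(m : ℤ) then
        qIntZ (2 * (n : ℤ)) * qIntZ (n : ℤ) / (((n : ℤ) : Kt)) else 0) • 1 := by
  have h := RingQuot.mkAlgHom_rel Kt (QHeisRel.comm n m)
  rw [map_mul, map_sub, map_mul, map_smul, map_one] at h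
  exact h

/-- `p_j` for `j : ℕ`, with the convention `p_0 = 0`. -/
noncomputable def pPosNat : ℕ → QHeis
  | 0 => 0
  | j + 1 => pPosQ j

/-- `p_{-j}` for `j : ℕ`, with the convention `p_0 = 0`. -/
noncomputable def pNegNat : ℕ → QHeis
  | 0 => 0
  | j + 1 => pNegQ j

theorem commute_pPosNat (i j : ℕ) : Commute (pPosNat i) (pPosNat j) := by
  rcases i with _ | i <;> rcases j with _ | j <;> simp only [pPosNat]
  · exact Commute.zero_left _
  · exact Commute.zero_left _
  · exact Commute.zero_right _
  · have h := PQ_mul_PQ ⟨(i : ℤ) + 1, by positivity⟩ ⟨(j : ℤ) + 1, by positivity⟩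
    rw [if_neg (by dsimp only; omega), zero_smul, sub_zero] at h
    exact h

theorem commute_pNegNat (i j : ℕ) : Commute (pNegNat i) (pNegNat j) := by
  rcases i with _ | i <;> rcases j with _ | j <;> simp only [pNegNat]
  · exact Commute.zero_left _
  · exact Commute.zero_left _
  · exact Commute.zero_right _
  · have h := PQ_mul_PQ ⟨-((i : ℤ) + 1), neg_ne_zero.mpr (by positivity)⟩
      ⟨-((j : ℤ) + 1), neg_ne_zero.mpr (by positivity)⟩
    rw [if_neg (by dsimp only; omega), zero_smul, sub_zero] at h
    exact h

theorem qIntZ_neg_natCast (k : ℕ) : qIntZ (-(k : ℤ)) = -qInt k := by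
  rcases k with _ | k
  · simp [qIntZ, qInt]
  · rw [qIntZ, if_neg (by omega), neg_neg, Int.toNat_natCast]

theorem neg_div_neg_right {F : Type*} [Field F] (x y : F) : -(x / -y) = x / y := by
  rw [div_neg, neg_neg]

theorem pNegNat_mul_pPosNat {m : ℕ} (hm : m ≠ 0) (j : ℕ) :
    pNegNat m * pPosNat j = pPosNat j * pNegNat m
      + (if j = m then qInt (2 * m) * qInt m / (m : Kt) else 0) • 1 := by
  obtain ⟨m, rfl⟩ := Nat.exists_eq_succ_of_ne_zero hm
  rcases j with _ | j
  · simp [pPosNat]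
  have h := PQ_mul_PQ ⟨-((m : ℤ) + 1), neg_ne_zero.mpr (by positivity)⟩
    ⟨(j : ℤ) + 1, by positivity⟩
  change pNegQ m * pPosQ j = pPosQ j * pNegQ m - _ at h
  change pNegQ m * pPosQ j = pPosQ j * pNegQ m + _
  rw [h]
  dsimp only
  by_cases hj : j = m
  · subst hj
    rw [if_pos rfl, if_pos rfl, sub_eq_add_neg]
    refine congrArg _ ((neg_smul _ _).symm.trans (congrArg (· • (1 : QHeis)) ?_))
    rw [show (2 : ℤ) * -((j : ℤ) + 1) = -((2 * (j + 1) : ℕ) : ℤ) by push_cast; ring,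
      show -((j : ℤ) + 1) = -((j + 1 : ℕ) : ℤ) by push_cast; ring, qIntZ_neg_natCast,
      qIntZ_neg_natCast]
    rw [neg_mul_neg, Int.cast_neg, Int.cast_natCast]
    exact neg_div_neg_right _ _
  · rw [if_neg (by omega), if_neg (by omega)]
    simp

theorem aElQ_zero : aElQ 0 = 1 := by rw [aElQ]

theorem bElQ_zero : bElQ 0 = 1 := by rw [bElQ]

theorem natCast_smul_aElQ (n : ℕ) : (n : Kt) • aElQ n
    = ∑ x ∈ antidiagonal n, ((x.1 : Kt) / qInt x.1) • (pPosNat x.1 * aElQ x.2) := by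
  rcases n with _ | n
  · simp
  have hn : ((n + 1 : ℕ) : Kt) ≠ 0 := by exact_mod_cast Nat.succ_ne_zero n
  rw [aElQ, smul_smul, mul_inv_cancel₀ hn, one_smul, Nat.sum_antidiagonal_succ,
    Nat.sum_antidiagonal_eq_sum_range_succ_mk]
  simp [pPosNat]

theorem natCast_smul_bElQ (n : ℕ) : (n : Kt) • bElQ n
    = ∑ x ∈ antidiagonal n, ((x.1 : Kt) / qInt x.1) • (pNegNat x.1 * bElQ x.2) := by
  rcases n with _ | n
  · simp
  have hn : ((n + 1 : ℕ) : Kt) ≠ 0 := by exact_mod_cast Nat.succ_ne_zero n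
  rw [bElQ, smul_smul, mul_inv_cancel₀ hn, one_smul, Nat.sum_antidiagonal_succ,
    Nat.sum_antidiagonal_eq_sum_range_succ_mk]
  simp [pNegNat]

theorem commute_aElQ_of_commute {x : QHeis} (hx : ∀ j, Commute x (pPosNat j)) (n : ℕ) :
    Commute x (aElQ n) :=
  commute_of_recursion (c := fun j => (j : Kt) / qInt j) aElQ_zero (by simp)
    natCast_smul_aElQ hx n

theorem commute_aElQ (n m : ℕ) : Commute (aElQ n) (aElQ m) :=
  commute_aElQ_of_commute
    (fun j => (commute_aElQ_of_commute (commute_pPosNat j) n).symm) m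

theorem commute_bElQ_of_commute {x : QHeis} (hx : ∀ j, Commute x (pNegNat j)) (n : ℕ) :
    Commute x (bElQ n) :=
  commute_of_recursion (c := fun j => (j : Kt) / qInt j) bElQ_zero (by simp)
    natCast_smul_bElQ hx n

theorem commute_bElQ (n m : ℕ) : Commute (bElQ n) (bElQ m) :=
  commute_bElQ_of_commute
    (fun j => (commute_bElQ_of_commute (commute_pNegNat j) n).symm) m

theorem pNegNat_mul_aElQ {m : ℕ} (hm : m ≠ 0) (n : ℕ) :
    pNegNat m * aElQ n = aElQ n * pNegNat m + (qInt (2 * m) / (m : Kt)) • shiftEntry aElQ n m := by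
  refine mul_eq_mul_add_shiftEntry (c := fun j => (j : Kt) / qInt j) aElQ_zero (by simp) hm
    natCast_smul_aElQ (pNegNat_mul_pPosNat hm) ?_ n
  have h1 : qInt m ≠ 0 := qInt_ne_zero hm
  have h2 : (m : Kt) ≠ 0 := by exact_mod_cast hm
  field_simp

theorem bElQ_mul_aElQ (n m : ℕ) : bElQ n * aElQ m
    = ∑ x ∈ antidiagonal n, qInt (x.1 + 1) • (shiftEntry aElQ m x.1 * bElQ x.2) :=
  mul_eq_sum_shiftEntry (c := fun j => (j : Kt) / qInt j) (w := fun k => qInt (k + 1))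
    bElQ_zero (by simp) (by simp [qInt]) natCast_smul_bElQ (fun _ hm => pNegNat_mul_aElQ hm)
    sum_antidiagonal_mul_qInt n m

end Heisenberg

/-- in `𝔥_t` one has
`b^{(n)} a^{(m)} = Σ_{k=0}^{min(n,m)} [k+1] a^{(m−k)} b^{(n−k)}`, and the `a`'s
(resp. the `b`'s) commute among themselves. -/
theorem quantum_heisenberg_relations (n m : ℕ) :
    (bElQ n * aElQ m
      = ∑ k ∈ Finset.range (min n m + 1), qInt (k + 1) • (aElQ (m - k) * bElQ (n - k)))
    ∧ aElQ n * aElQ m = aElQ m * aElQ n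
    ∧ bElQ n * bElQ m = bElQ m * bElQ n := by
  refine ⟨?_, commute_aElQ n m, commute_bElQ n m⟩
  rw [bElQ_mul_aElQ, Nat.sum_antidiagonal_eq_sum_range_succ_mk]
  symm
  refine sum_subset_zero_on_sdiff (range_subset_range.mpr (by omega)) ?_ ?_
  · intro k hk
    simp only [mem_sdiff, mem_range] at hk
    rw [shiftEntry, if_neg (by omega), zero_mul, smul_zero]
  · intro k hk
    have hk := mem_range.mp hk
    rw [shiftEntry, if_pos (by omega)]
end

section
/- Let q ∈ ℂ be nonzero and not a nontrivial root of unity, and let n ≥ 1. There is an isomorphism of (H_n(q), H_n(q))-bimodules H_{n+1}(q) ≅ H_n(q) ⊕ (H_n(q) ⊗_{H_{n−1}(q)} H_n(q)), under which the first summand maps to H_{n+1}(q) via ι_n and the second summand maps via x ⊗ y ↦ ι_n(x) t_n ι_n(y). -/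
open scoped TensorProduct

/-- The defining relations of the Hecke algebra `H_n(q)`, on generators
`t_1, …, t_{n−1}` (the generator `FreeAlgebra.ι ℂ i` for `i : Fin (n-1)` is `t_{i+1}`):
the quadratic relations `t_i² = q + (q−1)t_i`, the commutation relations
`t_i t_j = t_j t_i` for `|i−j| > 1`, and the braid relations
`t_i t_{i+1} t_i = t_{i+1} t_i t_{i+1}`. -/
inductive HeckeRel (q : ℂ) (n : ℕ) :
    FreeAlgebra ℂ (Fin (n - 1)) → FreeAlgebra ℂ (Fin (n - 1)) → Prop
  | quad (i : Fin (n - 1)) :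
      HeckeRel q n (FreeAlgebra.ι ℂ i * FreeAlgebra.ι ℂ i)
        (q • 1 + (q - 1) • FreeAlgebra.ι ℂ i)
  | comm (i j : Fin (n - 1)) (h : (i : ℕ) + 1 < (j : ℕ) ∨ (j : ℕ) + 1 < (i : ℕ)) :
      HeckeRel q n (FreeAlgebra.ι ℂ i * FreeAlgebra.ι ℂ j)
        (FreeAlgebra.ι ℂ j * FreeAlgebra.ι ℂ i)
  | braid (i j : Fin (n - 1)) (h : (j : ℕ) = (i : ℕ) + 1) :
      HeckeRel q n (FreeAlgebra.ι ℂ i * FreeAlgebra.ι ℂ j * FreeAlgebra.ι ℂ i)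
        (FreeAlgebra.ι ℂ j * FreeAlgebra.ι ℂ i * FreeAlgebra.ι ℂ j)

/-- The Hecke algebra `H_n(q)`. -/
abbrev Hecke (q : ℂ) (n : ℕ) : Type := RingQuot (HeckeRel q n)

/-- The generator `t_{i+1}` of `H_n(q)`, for `i : Fin (n-1)`. -/
noncomputable def T (q : ℂ) (n : ℕ) (i : Fin (n - 1)) : Hecke q n :=
  RingQuot.mkAlgHom ℂ (HeckeRel q n) (FreeAlgebra.ι ℂ i)

/-- The generator `t_{j+1}` of `H_n(q)` for a natural number index `j` (so `tN q n j`
is the `(j+1)`-st standard generator, defined to be `0` if `j` is out of range). -/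
noncomputable def tN (q : ℂ) (n : ℕ) (j : ℕ) : Hecke q n :=
  if h : j < n - 1 then T q n ⟨j, h⟩ else 0

/-- Given the inclusion `ι₁ : H_n(q) → H_{n+1}(q)`, the ℂ-bilinear map
`(x, y) ↦ ι₁(x) · t_n · ι₁(y)` into `H_{n+1}(q)`. -/
noncomputable def midMul (q : ℂ) (n : ℕ) (ι₁ : Hecke q n →ₐ[ℂ] Hecke q (n + 1)) :
    Hecke q n →ₗ[ℂ] Hecke q n →ₗ[ℂ] Hecke q (n + 1) :=
  LinearMap.mk₂ ℂ (fun x y => ι₁ x * tN q (n + 1) (n - 1) * ι₁ y)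
    (fun x x' y => by simp [map_add, add_mul])
    (fun c x y => by simp [map_smul, smul_mul_assoc])
    (fun x y y' => by simp [map_add, mul_add])
    (fun c x y => by simp [map_smul, mul_smul_comm])

/-- The ℂ-linear map `H_n(q) × (H_n(q) ⊗_ℂ H_n(q)) → H_{n+1}(q)` given by
`(a, x ⊗ y) ↦ ι₁(a) + ι₁(x) · t_n · ι₁(y)`. -/
noncomputable def heckePsi (q : ℂ) (n : ℕ) (ι₁ : Hecke q n →ₐ[ℂ] Hecke q (n + 1)) :
    Hecke q n × (Hecke q n ⊗[ℂ] Hecke q n) →ₗ[ℂ] Hecke q (n + 1) :=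
  LinearMap.coprod ι₁.toLinearMap (TensorProduct.lift (midMul q n ι₁))

/-- The ℂ-subspace of `H_n(q) ⊗_ℂ H_n(q)` spanned by the `H_{n-1}(q)`-balanced
differences `(x · ι₀(c)) ⊗ y − x ⊗ (ι₀(c) · y)`; the quotient of `H_n(q) ⊗_ℂ H_n(q)`
by this subspace is `H_n(q) ⊗_{H_{n−1}(q)} H_n(q)`. -/
noncomputable def balancedSub (q : ℂ) (n : ℕ)
    (ι₀ : Hecke q (n - 1) →ₐ[ℂ] Hecke q n) : Submodule ℂ (Hecke q n ⊗[ℂ] Hecke q n) :=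
  Submodule.span ℂ
    {z | ∃ (x y : Hecke q n) (c : Hecke q (n - 1)),
      z = (x * ι₀ c) ⊗ₜ[ℂ] y - x ⊗ₜ[ℂ] (ι₀ c * y)}

/-- A sequence `a` whose first `m` terms satisfy the type `A` Hecke relations. -/
structure IsHeckeSeq {A : Type*} [Semiring A] [Algebra ℂ A] (q : ℂ) (m : ℕ) (a : ℕ → A) : Prop where
  quad : ∀ i, i < m → a i * a i = q • 1 + (q - 1) • a i
  comm : ∀ i j, i + 1 < j → j < m → a i * a j = a j * a i
  braid : ∀ i, i + 1 < m → a i * a (i + 1) * a i = a (i + 1) * a i * a (i + 1)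

theorem isHeckeSeq_tN (q : ℂ) (n : ℕ) : IsHeckeSeq q (n - 1) (tN q n) where
  quad i hi := by
    simp only [tN, hi, dif_pos, T]
    rw [← map_mul, RingQuot.mkAlgHom_rel ℂ (HeckeRel.quad ⟨i, hi⟩)]
    simp
  comm i j hij hj := by
    have hi : i < n - 1 := by omega
    simp only [tN, hi, hj, dif_pos, T]
    rw [← map_mul, RingQuot.mkAlgHom_rel ℂ (HeckeRel.comm ⟨i, hi⟩ ⟨j, hj⟩ (Or.inl hij)), map_mul]
  braid i hj := by
    have hi : i < n - 1 := by omega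
    simp only [tN, hi, hj, dif_pos, T]
    rw [← map_mul, ← map_mul,
      RingQuot.mkAlgHom_rel ℂ (HeckeRel.braid ⟨i, hi⟩ ⟨i + 1, hj⟩ rfl), map_mul, map_mul]

/-- The universal property of the Hecke algebra. -/
theorem exists_heckeLift {A : Type*} [Semiring A] [Algebra ℂ A] (q : ℂ) (n : ℕ) (a : ℕ → A)
    (ha : IsHeckeSeq q (n - 1) a) :
    ∃ ρ : Hecke q n →ₐ[ℂ] A, ∀ j, j < n - 1 → ρ (tN q n j) = a j := by
  let g : FreeAlgebra ℂ (Fin (n - 1)) →ₐ[ℂ] A := FreeAlgebra.lift ℂ fun i => a i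
  have hg : ∀ ⦃x y⦄, HeckeRel q n x y → g x = g y := by
    intro x y h
    cases h with
    | quad i => simpa [g] using ha.quad i i.2
    | comm i j h =>
      rcases h with h | h
      · simpa [g] using ha.comm i j h j.2
      · simpa [g] using (ha.comm j i h i.2).symm
    | braid i j h =>
      have := ha.braid i (h ▸ j.2)
      simpa [g, h] using this
  refine ⟨RingQuot.liftAlgHom ℂ ⟨g, hg⟩, fun j hj => ?_⟩
  simp [tN, hj, T, g]

/-- A subspace stable under left multiplication by the generators is a left ideal. -/
theorem mul_mem_of_tN_mul_mem (q : ℂ) (n : ℕ) (S : Submodule ℂ (Hecke q n))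
    (hS : ∀ j, j < n - 1 → ∀ y ∈ S, tN q n j * y ∈ S) (x : Hecke q n) :
    ∀ y ∈ S, x * y ∈ S := by
  obtain ⟨x, rfl⟩ := RingQuot.mkAlgHom_surjective ℂ (HeckeRel q n) x
  induction x using FreeAlgebra.induction with
  | grade0 r =>
    intro y hy
    simpa [Algebra.algebraMap_eq_smul_one] using S.smul_mem r hy
  | grade1 i =>
    intro y hy
    simpa [tN, T] using hS i i.2 y hy
  | mul a b ha hb =>
    intro y hy
    rw [map_mul, mul_assoc]
    exact ha _ (hb _ hy)
  | add a b ha hb =>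
    intro y hy
    rw [map_add, add_mul]
    exact S.add_mem (ha _ hy) (hb _ hy)

/-- The product `a p * a (p + 1) * ⋯ * a (n - 1)`. -/
def ascProd {A : Type*} [Monoid A] (a : ℕ → A) : ℕ → ℕ → A
  | 0, _ => 1
  | n + 1, p => if p ≤ n then ascProd a n p * a n else 1

section ascProd

theorem ascProd_of_le {A : Type*} [Monoid A] (a : ℕ → A) {n p : ℕ} (h : n ≤ p) : ascProd a n p = 1 := by
  cases n with
  | zero => rfl
  | succ n => rw [ascProd, if_neg (by omega)]

theorem ascProd_succ {A : Type*} [Monoid A] (a : ℕ → A) {n p : ℕ} (h : p ≤ n) :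
    ascProd a (n + 1) p = ascProd a n p * a n := by
  rw [ascProd, if_pos h]

theorem ascProd_eq_mul {A : Type*} [Monoid A] (a : ℕ → A) {n p : ℕ} (h : p < n) :
    ascProd a n p = a p * ascProd a n (p + 1) := by
  induction n with
  | zero => omega
  | succ n ih =>
    rcases Nat.lt_succ_iff_lt_or_eq.mp h with h' | rfl
    · rw [ascProd_succ a h'.le, ascProd_succ a h', ih h', mul_assoc]
    · rw [ascProd_succ a le_rfl, ascProd_of_le a le_rfl, ascProd_of_le a le_rfl, one_mul, mul_one]

variable {A : Type*} [Semiring A] [Algebra ℂ A] {q : ℂ} {a : ℕ → A}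

theorem map_ascProd {B : Type*} [Semiring B] [Algebra ℂ B] (f : A →ₐ[ℂ] B) (b : ℕ → B) (n p : ℕ)
    (h : ∀ j, j < n → f (a j) = b j) : f (ascProd a n p) = ascProd b n p := by
  induction n with
  | zero => simp [ascProd]
  | succ n ih =>
    by_cases hp : p ≤ n
    · rw [ascProd_succ a hp, ascProd_succ b hp, map_mul, ih fun j hj => h j (by omega),
        h n (by omega)]
    · rw [ascProd_of_le a (by omega), ascProd_of_le b (by omega), map_one]

theorem IsHeckeSeq.mul_ascProd_of_lt {m : ℕ} (ha : IsHeckeSeq q m a) {n p j : ℕ} (hn : n ≤ m)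
    (h : j + 1 < p) : a j * ascProd a n p = ascProd a n p * a j := by
  induction n with
  | zero => simp [ascProd]
  | succ n ih =>
    by_cases hp : p ≤ n
    · rw [ascProd_succ a hp, ← mul_assoc, ih (by omega), mul_assoc, mul_assoc,
        ha.comm j n (by omega) (by omega)]
    · simp [ascProd_of_le a (show n + 1 ≤ p by omega)]

theorem IsHeckeSeq.mul_ascProd_of_gt_range {m : ℕ} (ha : IsHeckeSeq q m a) {n p j : ℕ}
    (hn : n < j) (hj : j < m) : a j * ascProd a n p = ascProd a n p * a j := by
  induction n with
  | zero => simp [ascProd]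
  | succ n ih =>
    by_cases hp : p ≤ n
    · rw [ascProd_succ a hp, ← mul_assoc, ih (by omega), mul_assoc, mul_assoc,
        ha.comm n j (by omega) hj]
    · simp [ascProd_of_le a (show n + 1 ≤ p by omega)]

theorem IsHeckeSeq.mul_ascProd_self {m : ℕ} (ha : IsHeckeSeq q m a) {n p : ℕ} (hn : n ≤ m)
    (h : p < n) :
    a p * ascProd a n p = q • ascProd a n (p + 1) + (q - 1) • ascProd a n p := by
  rw [ascProd_eq_mul a h, ← mul_assoc, ha.quad p (by omega), add_mul, smul_mul_assoc, one_mul,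
    smul_mul_assoc]

theorem IsHeckeSeq.mul_ascProd_of_gt {m : ℕ} (ha : IsHeckeSeq q m a) {n p j : ℕ} (hn : n ≤ m)
    (h : p ≤ j) (hj : j + 1 < n) :
    a (j + 1) * ascProd a n p = ascProd a n p * a j := by
  induction n with
  | zero => omega
  | succ n ih =>
    rcases Nat.lt_succ_iff_lt_or_eq.mp hj with hj' | rfl
    · rw [ascProd_succ a (by omega), ← mul_assoc, ih (by omega) hj', mul_assoc, mul_assoc,
        ha.comm j n hj' (by omega)]
    · rw [ascProd_succ a (by omega), ascProd_succ a h, ← mul_assoc, ← mul_assoc,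
        ha.mul_ascProd_of_gt_range (by omega) (by omega), mul_assoc, mul_assoc,
        ← mul_assoc (a (j + 1)), ← ha.braid j (by omega)]
      simp only [mul_assoc]

end ascProd

theorem map_tN (q : ℂ) (n : ℕ) (ι : Hecke q n →ₐ[ℂ] Hecke q (n + 1))
    (hι : ∀ i : Fin (n - 1), ι (T q n i) = tN q (n + 1) (i : ℕ)) (j : ℕ) (hj : j < n - 1) :
    ι (tN q n j) = tN q (n + 1) j := by
  rw [← hι ⟨j, hj⟩, tN, dif_pos hj]

/-- `H_{n+1}(q)` is generated as a right `H_n(q)`-module by the products `t_{p+1} ⋯ t_n`. -/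
theorem exists_eq_sum_ascProd_mul (q : ℂ) (n : ℕ) (ι : Hecke q n →ₐ[ℂ] Hecke q (n + 1))
    (hι : ∀ i : Fin (n - 1), ι (T q n i) = tN q (n + 1) (i : ℕ)) (x : Hecke q (n + 1)) :
    ∃ c : ℕ → Hecke q n,
      x = ∑ p ∈ Finset.range (n + 1), ascProd (tN q (n + 1)) n p * ι (c p) := by
  have ha : IsHeckeSeq q n (tN q (n + 1)) := isHeckeSeq_tN q (n + 1)
  let w := ascProd (tN q (n + 1)) n
  let S : Submodule ℂ (Hecke q (n + 1)) := ⨆ p ∈ Finset.range (n + 1),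
    LinearMap.range (LinearMap.mulLeft ℂ (w p) ∘ₗ ι.toLinearMap)
  have mem : ∀ p, p ≤ n → ∀ c, w p * ι c ∈ S := fun p hp c =>
    Submodule.mem_iSup_of_mem p (Submodule.mem_iSup_of_mem (by simp; omega) ⟨c, rfl⟩)
  have stable : ∀ j, j < n → ∀ y ∈ S, tN q (n + 1) j * y ∈ S := by
    intro j hj
    suffices h : S ≤ S.comap (LinearMap.mulLeft ℂ (tN q (n + 1) j)) from fun y hy => h hy
    refine iSup₂_le fun p hp => ?_
    rintro _ ⟨c, rfl⟩
    have hp : p ≤ n := by simpa [Nat.lt_succ_iff] using hp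
    change tN q (n + 1) j * (w p * ι c) ∈ S
    rw [← mul_assoc]
    rcases lt_trichotomy (j + 1) p with h | rfl | h
    · rw [ha.mul_ascProd_of_lt le_rfl h, mul_assoc, ← map_tN q n ι hι j (by omega), ← map_mul]
      exact mem p hp _
    · rw [← ascProd_eq_mul _ hj]
      exact mem j hj.le c
    · rcases Nat.lt_succ_iff_lt_or_eq.mp h with h | rfl
      · obtain ⟨i, rfl⟩ : ∃ i, j = i + 1 := ⟨j - 1, by omega⟩
        rw [ha.mul_ascProd_of_gt le_rfl (by omega) hj, mul_assoc,
          ← map_tN q n ι hι i (by omega), ← map_mul]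
        exact mem p hp _
      · rw [ha.mul_ascProd_self le_rfl hj, add_mul, smul_mul_assoc, smul_mul_assoc]
        exact S.add_mem (S.smul_mem _ (mem _ hj c)) (S.smul_mem _ (mem _ hp c))
  have one_mem : (1 : Hecke q (n + 1)) ∈ S := by
    simpa [w, ascProd_of_le] using mem n le_rfl 1
  have hx : x ∈ S := by
    simpa using mul_mem_of_tN_mul_mem q (n + 1) S stable x 1 one_mem
  obtain ⟨μ, hμ⟩ := (Submodule.mem_iSup_finset_iff_exists_sum _ _).mp hx
  choose c hc using fun p => (μ p).2
  exact ⟨c, by rw [← hμ]; exact Finset.sum_congr rfl fun p _ => (hc p).symm⟩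

/-- The action of the generator `t_{j+1}` of `H_{n+1}(q)` on the coordinates of elements of
`H_{n+1}(q)` in the basis `t_{p+1} ⋯ t_n`, `p ≤ n`, over `H_n(q)`. Coordinates beyond `n` are
irrelevant, and are scaled by `q` so that the Hecke relations hold there too. -/
noncomputable def coordAct {A : Type*} [Semiring A] [Algebra ℂ A] (q : ℂ) (n : ℕ) (a : ℕ → A)
    (j : ℕ) : Module.End ℂ (ℕ → A) where
  toFun f p :=
    if p = j then f (j + 1) + (q - 1) • f j
    else if p = j + 1 then q • f j
    else if n < p then q • f p
    else if p < j then a (j - 1) * f p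
    else a j * f p
  map_add' f g := by
    ext p
    simp only [Pi.add_apply]
    split_ifs <;> simp only [smul_add, mul_add]
    abel
  map_smul' r f := by
    ext p
    simp only [Pi.smul_apply, RingHom.id_apply]
    split_ifs <;> simp only [smul_add, mul_smul_comm, smul_comm r]

section coordAct

variable {A : Type*} [Semiring A] [Algebra ℂ A] {q : ℂ} {n : ℕ} {a : ℕ → A} {j p : ℕ} {f : ℕ → A}

theorem coordAct_eq (h : p = j) : coordAct q n a j f p = f (p + 1) + (q - 1) • f p := by
  simp [coordAct, h]

theorem coordAct_succ (h : p = j + 1) : coordAct q n a j f p = q • f (p - 1) := by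
  simp [coordAct, h]

theorem coordAct_out (hj : j < n) (h : n < p) : coordAct q n a j f p = q • f p := by
  simp [coordAct, h, show p ≠ j by omega, show p ≠ j + 1 by omega]

theorem coordAct_lt (hn : p ≤ n) (h : p < j) :
    coordAct q n a j f p = a (j - 1) * f p := by
  simp [coordAct, h, show p ≠ j by omega, show p ≠ j + 1 by omega, show ¬ n < p by omega]

theorem coordAct_gt (hn : p ≤ n) (h : j + 1 < p) :
    coordAct q n a j f p = a j * f p := by
  simp [coordAct, show ¬ p < j by omega, show p ≠ j by omega, show p ≠ j + 1 by omega,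
    show ¬ n < p by omega]

theorem isHeckeSeq_coordAct (ha : IsHeckeSeq q (n - 1) a) :
    IsHeckeSeq q n (coordAct q n a) where
  quad j hj := by
    ext f p
    simp only [Module.End.mul_apply, LinearMap.add_apply, LinearMap.smul_apply,
      Module.End.one_apply, Pi.add_apply, Pi.smul_apply]
    have cases : n < p ∨ p ≤ n ∧ (p < j ∨ p = j ∨ p = j + 1 ∨ j + 1 < p) := by omega
    rcases cases with h | ⟨h, h' | h' | h' | h'⟩
    · simp (disch := omega) only [coordAct_out]
      module
    · simp (disch := omega) only [coordAct_lt]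
      rw [← mul_assoc, ha.quad _ (by omega), add_mul, smul_mul_assoc, one_mul, smul_mul_assoc]
    · simp (disch := omega) only [coordAct_eq, coordAct_succ, Nat.add_sub_cancel]
    · obtain rfl := h'
      simp (disch := omega) only [coordAct_eq, coordAct_succ, Nat.add_sub_cancel]
      module
    · simp (disch := omega) only [coordAct_gt]
      rw [← mul_assoc, ha.quad _ (by omega), add_mul, smul_mul_assoc, one_mul, smul_mul_assoc]
  comm i j hij hj := by
    ext f p
    simp only [Module.End.mul_apply]
    have cases : n < p ∨ p ≤ n ∧ (p < i ∨ p = i ∨ p = i + 1 ∨ i + 1 < p ∧ p < j ∨ p = j ∨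
      p = j + 1 ∨ j + 1 < p) := by omega
    rcases cases with h | ⟨h, h' | h' | h' | h' | h' | h' | h'⟩
    · simp (disch := omega) only [coordAct_out]
    · simp (disch := omega) only [coordAct_lt]
      rw [← mul_assoc, ← mul_assoc, ha.comm (i - 1) (j - 1) (by omega) (by omega)]
    · simp (disch := omega) only [coordAct_eq, coordAct_lt, mul_add, mul_smul_comm]
    · simp (disch := omega) only [coordAct_succ, coordAct_lt, mul_smul_comm]
    · simp (disch := omega) only [coordAct_gt, coordAct_lt]
      rw [← mul_assoc, ← mul_assoc, ha.comm i (j - 1) (by omega) (by omega)]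
    · simp (disch := omega) only [coordAct_eq, coordAct_gt, mul_add, mul_smul_comm]
    · simp (disch := omega) only [coordAct_succ, coordAct_gt, mul_smul_comm]
    · simp (disch := omega) only [coordAct_gt]
      rw [← mul_assoc, ← mul_assoc, ha.comm i j hij (by omega)]
  braid i hi := by
    ext f p
    simp only [Module.End.mul_apply]
    have cases : n < p ∨ p ≤ n ∧ (p < i ∨ p = i ∨ p = i + 1 ∨ p = i + 1 + 1 ∨ i + 2 < p) := by omega
    rcases cases with h | ⟨h, h' | rfl | rfl | rfl | h'⟩
    · simp (disch := omega) only [coordAct_out]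
    · simp (disch := omega) only [coordAct_lt]
      obtain ⟨k, rfl⟩ : ∃ k, i = k + 1 := ⟨i - 1, by omega⟩
      have := ha.braid k (by omega)
      simp only [Nat.add_sub_cancel, ← mul_assoc, this]
    · simp (disch := omega) only [coordAct_eq, coordAct_lt, coordAct_gt, coordAct_succ,
        Nat.add_sub_cancel, mul_add, mul_smul_comm]
      rw [← mul_assoc, ha.quad _ (by omega), add_mul, smul_mul_assoc, one_mul, smul_mul_assoc]
      module
    · simp (disch := omega) only [coordAct_eq, coordAct_lt, coordAct_gt, coordAct_succ,
        Nat.add_sub_cancel, mul_add, mul_smul_comm]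
      module
    · simp (disch := omega) only [coordAct_lt, coordAct_gt, coordAct_succ, Nat.add_sub_cancel,
        mul_smul_comm]
    · simp (disch := omega) only [coordAct_gt]
      have := ha.braid i (by omega)
      simp only [← mul_assoc, this]

theorem coordAct_single_top (hj : j < n - 1) (h : A) :
    coordAct q n a j (Pi.single n h) = Pi.single n (a j * h) := by
  ext p
  simp only [coordAct, LinearMap.coe_mk, AddHom.coe_mk, Pi.single_apply]
  split_ifs <;> first | omega | simp

theorem coordAct_single_succ (h : A) :
    coordAct q n a j (Pi.single (j + 1) h) = Pi.single j h := by
  ext p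
  simp only [coordAct, LinearMap.coe_mk, AddHom.coe_mk, Pi.single_apply]
  split_ifs <;> first | omega | simp

theorem ascProd_coordAct_single (hp : p ≤ n) (h : A) :
    ascProd (coordAct q n a) n p (Pi.single n h) = Pi.single p h := by
  induction hp using Nat.decreasingInduction with
  | self => simp [ascProd_of_le]
  | of_succ k hk ih =>
    rw [ascProd_eq_mul _ hk, Module.End.mul_apply, ih, coordAct_single_succ]

end coordAct

/-- The products `t_{p+1} ⋯ t_n`, `p ≤ n`, are right linearly independent over `H_n(q)`. -/
theorem eq_zero_of_sum_ascProd_mul_eq_zero (q : ℂ) (n : ℕ)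
    (ι : Hecke q n →ₐ[ℂ] Hecke q (n + 1))
    (hι : ∀ i : Fin (n - 1), ι (T q n i) = tN q (n + 1) (i : ℕ)) (c : ℕ → Hecke q n)
    (hc : ∑ p ∈ Finset.range (n + 1), ascProd (tN q (n + 1)) n p * ι (c p) = 0) (p : ℕ)
    (hp : p ≤ n) : c p = 0 := by
  obtain ⟨ρ, hρ⟩ : ∃ ρ : Hecke q (n + 1) →ₐ[ℂ] Module.End ℂ (ℕ → Hecke q n),
      ∀ j, j < n → ρ (tN q (n + 1) j) = coordAct q n (tN q n) j :=
    exists_heckeLift q (n + 1) _ (isHeckeSeq_coordAct (isHeckeSeq_tN q n))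
  let e : Hecke q n →ₗ[ℂ] ℕ → Hecke q n := LinearMap.single ℂ (fun _ : ℕ => Hecke q n) n
  have hρe : ∀ x, ρ (ι x) (Pi.single n 1) = e x := by
    let S : Submodule ℂ (Hecke q n) := LinearMap.eqLocus
      (LinearMap.applyₗ (Pi.single n 1) ∘ₗ ρ.toLinearMap ∘ₗ ι.toLinearMap) e
    have hS : ∀ x, x ∈ S ↔ ρ (ι x) (Pi.single n 1) = e x := fun x => Iff.rfl
    intro x
    rw [← hS, ← mul_one x]
    refine mul_mem_of_tN_mul_mem q n S (fun j hj y hy => ?_) x 1 (by simp [hS, e])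
    rw [hS] at hy ⊢
    rw [map_mul, map_mul, Module.End.mul_apply, hy, map_tN q n ι hι j hj, hρ j (by omega),
      LinearMap.single_apply, coordAct_single_top hj, LinearMap.single_apply]
  have key := congrArg (fun x => ρ x (Pi.single n 1) p) hc
  simp only [map_sum, map_mul, map_zero, LinearMap.sum_apply, Module.End.mul_apply, hρe, e,
    LinearMap.single_apply, LinearMap.zero_apply, Pi.zero_apply, Finset.sum_apply] at key
  rw [Finset.sum_eq_single_of_mem p (by simp; omega)] at key
  · rwa [map_ascProd ρ _ n p hρ, ascProd_coordAct_single hp, Pi.single_eq_same] at key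
  · intro r hr hrp
    rw [map_ascProd ρ _ n r hρ, ascProd_coordAct_single (by simpa [Nat.lt_succ_iff] using hr),
      Pi.single_eq_of_ne hrp.symm]

/-- Modulo balanced differences, every tensor is a sum of tensors with left factors
`t_{p+1} ⋯ t_n`. -/
theorem exists_eq_balanced_add_sum (q : ℂ) (n : ℕ) (ι : Hecke q n →ₐ[ℂ] Hecke q (n + 1))
    (hι : ∀ i : Fin (n - 1), ι (T q n i) = tN q (n + 1) (i : ℕ))
    (z : Hecke q (n + 1) ⊗[ℂ] Hecke q (n + 1)) :
    ∃ c : ℕ → Hecke q (n + 1), ∃ b ∈ balancedSub q (n + 1) ι,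
      z = b + ∑ p ∈ Finset.range (n + 1), ascProd (tN q (n + 1)) n p ⊗ₜ[ℂ] c p := by
  induction z using TensorProduct.induction_on with
  | zero => exact ⟨0, 0, Submodule.zero_mem _, by simp⟩
  | tmul x y =>
    obtain ⟨c, rfl⟩ := exists_eq_sum_ascProd_mul q n ι hι x
    refine ⟨fun p => ι (c p) * y, _, Submodule.sum_mem _ fun p (_ : p ∈ Finset.range (n + 1)) =>
      Submodule.subset_span ⟨ascProd (tN q (n + 1)) n p, y, c p, rfl⟩, ?_⟩
    rw [TensorProduct.sum_tmul, ← Finset.sum_add_distrib]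
    exact Finset.sum_congr rfl fun p _ => (sub_add_cancel _ _).symm
  | add x y hx hy =>
    obtain ⟨c, b, hb, rfl⟩ := hx
    obtain ⟨d, b', hb', rfl⟩ := hy
    refine ⟨c + d, b + b', Submodule.add_mem _ hb hb', ?_⟩
    simp only [Pi.add_apply, TensorProduct.tmul_add, Finset.sum_add_distrib]
    abel

theorem map_commute_tN (q : ℂ) (n : ℕ) (ι₁ : Hecke q (n + 1) →ₐ[ℂ] Hecke q (n + 1 + 1))
    (hι₁ : ∀ i : Fin n, ι₁ (T q (n + 1) i) = tN q (n + 1 + 1) (i : ℕ))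
    (ι₀ : Hecke q n →ₐ[ℂ] Hecke q (n + 1))
    (hι₀ : ∀ i : Fin (n - 1), ι₀ (T q n i) = tN q (n + 1) (i : ℕ)) (c : Hecke q n) :
    ι₁ (ι₀ c) * tN q (n + 1 + 1) n = tN q (n + 1 + 1) n * ι₁ (ι₀ c) := by
  let S : Submodule ℂ (Hecke q n) := LinearMap.eqLocus
    (LinearMap.mulRight ℂ (tN q (n + 1 + 1) n) ∘ₗ ι₁.toLinearMap ∘ₗ ι₀.toLinearMap)
    (LinearMap.mulLeft ℂ (tN q (n + 1 + 1) n) ∘ₗ ι₁.toLinearMap ∘ₗ ι₀.toLinearMap)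
  have hS : ∀ x, x ∈ S ↔
      ι₁ (ι₀ x) * tN q (n + 1 + 1) n = tN q (n + 1 + 1) n * ι₁ (ι₀ x) := fun x => Iff.rfl
  rw [← hS, ← mul_one c]
  refine mul_mem_of_tN_mul_mem q n S (fun j hj y hy => ?_) c 1 (by simp [hS])
  rw [hS] at hy ⊢
  rw [map_mul, map_mul, map_tN q n ι₀ hι₀ j hj,
    map_tN q (n + 1) ι₁ hι₁ j (by simp; omega), mul_assoc, hy, ← mul_assoc, ← mul_assoc,
    (isHeckeSeq_tN q (n + 1 + 1)).comm j n (by omega) (by simp)]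

theorem heckePsi_sum_ascProd (q : ℂ) (n : ℕ) (ι₁ : Hecke q (n + 1) →ₐ[ℂ] Hecke q (n + 1 + 1))
    (hι₁ : ∀ i : Fin n, ι₁ (T q (n + 1) i) = tN q (n + 1 + 1) (i : ℕ))
    (c : ℕ → Hecke q (n + 1)) :
    heckePsi q (n + 1) ι₁ (c (n + 1), ∑ p ∈ Finset.range (n + 1),
        ascProd (tN q (n + 1)) n p ⊗ₜ[ℂ] c p) =
      ∑ p ∈ Finset.range (n + 1 + 1), ascProd (tN q (n + 1 + 1)) (n + 1) p * ι₁ (c p) := by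
  rw [Finset.sum_range_succ _ (n + 1), ascProd_of_le _ le_rfl, one_mul,
    add_comm (Finset.sum _ _)]
  simp only [heckePsi, LinearMap.coprod_apply, AlgHom.toLinearMap_apply, map_sum,
    TensorProduct.lift.tmul, midMul, LinearMap.mk₂_apply, Nat.add_sub_cancel]
  congr 1
  refine Finset.sum_congr rfl fun p hp => ?_
  rw [ascProd_succ _ (by simpa [Nat.lt_succ_iff] using hp),
    map_ascProd ι₁ (tN q (n + 1 + 1)) n p fun j hj => map_tN q (n + 1) ι₁ hι₁ j hj]

/-- Mackey-type bimodule decomposition for Hecke algebras: for `q`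
nonzero and not a nontrivial root of unity, and `n ≥ 1`, with `ι₁ : H_n(q) → H_{n+1}(q)`
and `ι₀ : H_{n-1}(q) → H_n(q)` the standard inclusions (`t_i ↦ t_i`), the map
`(a, x ⊗ y) ↦ ι₁(a) + ι₁(x) t_n ι₁(y)` is surjective onto `H_{n+1}(q)`, and its kernel
is exactly `0 ⊕ S` where `S` is the span of the `H_{n-1}(q)`-balanced differences.
Equivalently, there is an isomorphism of `(H_n(q), H_n(q))`-bimodules
`H_{n+1}(q) ≅ H_n(q) ⊕ (H_n(q) ⊗_{H_{n−1}(q)} H_n(q))` whose first component is `ι_n`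
and whose second component is `x ⊗ y ↦ ι_n(x) t_n ι_n(y)`. -/
theorem hecke_bimodule_decomposition (q : ℂ) (hq0 : q ≠ 0)
    (hq1 : ∀ k : ℕ, 0 < k → q ^ k = 1 → q = 1) (n : ℕ) (hn : 1 ≤ n)
    (ι₁ : Hecke q n →ₐ[ℂ] Hecke q (n + 1))
    (hι₁ : ∀ i : Fin (n - 1), ι₁ (T q n i) = tN q (n + 1) (i : ℕ))
    (ι₀ : Hecke q (n - 1) →ₐ[ℂ] Hecke q n)
    (hι₀ : ∀ i : Fin (n - 1 - 1), ι₀ (T q (n - 1) i) = tN q n (i : ℕ)) :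
    Function.Surjective (heckePsi q n ι₁)
    ∧ LinearMap.ker (heckePsi q n ι₁)
        = Submodule.prod ⊥ (balancedSub q n ι₀) := by
  obtain ⟨m, rfl⟩ : ∃ m, n = m + 1 := ⟨n - 1, by omega⟩
  have bal : ∀ z ∈ balancedSub q (m + 1) ι₀, heckePsi q (m + 1) ι₁ (0, z) = 0 := by
    intro z hz
    induction hz using Submodule.span_induction with
    | mem z hz =>
      obtain ⟨x, y, c, rfl⟩ := hz
      have := map_commute_tN q m ι₁ hι₁ ι₀ hι₀ c
      simp only [heckePsi, LinearMap.coprod_apply, map_zero, zero_add, map_sub,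
        TensorProduct.lift.tmul, midMul, LinearMap.mk₂_apply, Nat.add_sub_cancel, map_mul]
      rw [mul_assoc (ι₁ x), this]
      simp only [mul_assoc, sub_self]
    | zero => exact map_zero _
    | add x y _ _ hx hy =>
      rw [← zero_add (0 : Hecke q (m + 1)), ← Prod.mk_add_mk, map_add, hx, hy, add_zero]
    | smul r x _ hx =>
      rw [← smul_zero r, ← Prod.smul_mk, map_smul, hx]
      simp
  refine ⟨fun x => ?_, le_antisymm ?_ ?_⟩
  · obtain ⟨c, rfl⟩ := exists_eq_sum_ascProd_mul q (m + 1) ι₁ hι₁ x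
    exact ⟨_, heckePsi_sum_ascProd q m ι₁ hι₁ c⟩
  · rintro ⟨a, z⟩ h
    obtain ⟨c, b, hb, rfl⟩ := exists_eq_balanced_add_sum q m ι₀ hι₀ z
    let d : ℕ → Hecke q (m + 1) := fun p => if p = m + 1 then a else c p
    have hd : ∀ p ∈ Finset.range (m + 1), d p = c p := fun p hp =>
      if_neg (Finset.mem_range.mp hp).ne
    have hsum : ∑ p ∈ Finset.range (m + 1), ascProd (tN q (m + 1)) m p ⊗ₜ[ℂ] d p =
        ∑ p ∈ Finset.range (m + 1), ascProd (tN q (m + 1)) m p ⊗ₜ[ℂ] c p :=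
      Finset.sum_congr rfl fun p hp => by rw [hd p hp]
    have hda : d (m + 1) = a := if_pos rfl
    rw [← hsum] at h ⊢
    have hpsi : heckePsi q (m + 1) ι₁ (d (m + 1), ∑ p ∈ Finset.range (m + 1),
        ascProd (tN q (m + 1)) m p ⊗ₜ[ℂ] d p) = 0 := by
      rw [hda, ← zero_add (heckePsi _ _ _ _), ← bal b hb, ← map_add, Prod.mk_add_mk, zero_add, bal b hb]
      exact h
    rw [heckePsi_sum_ascProd q m ι₁ hι₁] at hpsi
    have hzero := eq_zero_of_sum_ascProd_mul_eq_zero q (m + 1) ι₁ hι₁ d hpsi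
    refine ⟨by simpa [hda] using hzero (m + 1) le_rfl, ?_⟩
    refine Submodule.add_mem _ hb (Submodule.sum_mem _ fun p hp => ?_)
    rw [hzero p (Finset.mem_range.mp hp).le, TensorProduct.tmul_zero]
    exact Submodule.zero_mem _
  · rintro ⟨a, z⟩ ⟨ha, hz⟩
    obtain rfl : a = 0 := ha
    exact bal z hz
end

section
/- For every n ≥ 1 there is an isomorphism of (ℂ[S_n], ℂ[S_n])-bimodules ℂ[S_{n+1}] ≅ ℂ[S_n] ⊕ (ℂ[S_n] ⊗_{ℂ[S_{n−1}]} ℂ[S_n]), under which the first summand maps to ℂ[S_{n+1}] via the inclusion and the second summand maps via x ⊗ y ↦ x s_n y, where s_n ∈ S_{n+1} is the transposition exchanging n and n+1. (This is the bimodule isomorphism, at q = 1, categorifying the Heisenberg commutation relation between induction and restriction for symmetric groups.) -/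
open scoped TensorProduct

/-- The group algebra `ℂ[S_k]` of the symmetric group on `{1, …, k}`. -/
abbrev GA (k : ℕ) : Type := MonoidAlgebra ℂ (Equiv.Perm (Fin k))

/-- The embedding `S_k ⊆ S_{k+1}` as permutations fixing the additional point. -/
noncomputable def permIncl (k : ℕ) : Equiv.Perm (Fin k) →* Equiv.Perm (Fin (k + 1)) :=
  Equiv.Perm.viaEmbeddingHom Fin.castSuccEmb

/-- The induced inclusion of group algebras `ℂ[S_k] → ℂ[S_{k+1}]`. -/
noncomputable def gaIncl (k : ℕ) : GA k →ₐ[ℂ] GA (k + 1) :=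
  MonoidAlgebra.mapDomainAlgHom ℂ ℂ (permIncl k)

/-- The transposition `s_n ∈ S_{n+1}` exchanging `n` and `n+1` (here `n = m+1`),
viewed in the group algebra `ℂ[S_{n+1}] = GA (m+2)`. -/
noncomputable def swapEl (m : ℕ) : GA (m + 2) :=
  MonoidAlgebra.of ℂ (Equiv.Perm (Fin (m + 2)))
    (Equiv.swap (⟨m, by omega⟩ : Fin (m + 2)) (⟨m + 1, by omega⟩ : Fin (m + 2)))

/-- The ℂ-bilinear map `(x, y) ↦ x s_n y : ℂ[S_n] × ℂ[S_n] → ℂ[S_{n+1}]` (with `n = m+1`). -/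
noncomputable def midMulS (m : ℕ) : GA (m + 1) →ₗ[ℂ] GA (m + 1) →ₗ[ℂ] GA (m + 2) :=
  LinearMap.mk₂ ℂ (fun x y => gaIncl (m + 1) x * swapEl m * gaIncl (m + 1) y)
    (fun x x' y => by simp [map_add, add_mul])
    (fun c x y => by simp [map_smul, smul_mul_assoc])
    (fun x y y' => by simp [map_add, mul_add])
    (fun c x y => by simp [map_smul, mul_smul_comm])

/-- The ℂ-linear map `ℂ[S_n] × (ℂ[S_n] ⊗_ℂ ℂ[S_n]) → ℂ[S_{n+1}]`,
`(a, x ⊗ y) ↦ a + x s_n y` (with `n = m+1`, all via the standard inclusions). -/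
noncomputable def symPsi (m : ℕ) :
    GA (m + 1) × (GA (m + 1) ⊗[ℂ] GA (m + 1)) →ₗ[ℂ] GA (m + 2) :=
  LinearMap.coprod (gaIncl (m + 1)).toLinearMap (TensorProduct.lift (midMulS m))

/-- The ℂ-subspace of `ℂ[S_n] ⊗_ℂ ℂ[S_n]` spanned by the `ℂ[S_{n−1}]`-balanced
differences `(x·c) ⊗ y − x ⊗ (c·y)` (with `n = m+1`); the quotient by this subspace
is `ℂ[S_n] ⊗_{ℂ[S_{n−1}]} ℂ[S_n]`. -/
noncomputable def balancedSubS (m : ℕ) : Submodule ℂ (GA (m + 1) ⊗[ℂ] GA (m + 1)) :=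
  Submodule.span ℂ
    {z | ∃ (x y : GA (m + 1)) (c : GA m),
      z = (x * gaIncl m c) ⊗ₜ[ℂ] y - x ⊗ₜ[ℂ] (gaIncl m c * y)}

/-- The transposition `s_n` as a group element, with `n = m + 1`. -/
def lastSwap (m : ℕ) : Equiv.Perm (Fin (m + 2)) :=
  Equiv.swap (Fin.last m).castSucc (Fin.last (m + 1))

@[simp]
theorem permIncl_castSucc {k : ℕ} (a : Equiv.Perm (Fin k)) (x : Fin k) :
    permIncl k a x.castSucc = (a x).castSucc :=
  a.viaEmbedding_apply Fin.castSuccEmb x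

@[simp]
theorem permIncl_last {k : ℕ} (a : Equiv.Perm (Fin k)) :
    permIncl k a (Fin.last k) = Fin.last k :=
  a.viaEmbedding_apply_of_notMem Fin.castSuccEmb _ <| by
    rintro ⟨x, hx⟩
    exact x.castSucc_ne_last hx

theorem permIncl_injective (k : ℕ) : Function.Injective (permIncl k) :=
  Equiv.Perm.viaEmbeddingHom_injective Fin.castSuccEmb

theorem castSucc_apply_ne_last {k : ℕ} {g : Equiv.Perm (Fin (k + 1))}
    (hg : g (Fin.last k) = Fin.last k) (x : Fin k) : g x.castSucc ≠ Fin.last k :=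
  fun h => x.castSucc_ne_last (g.injective (h.trans hg.symm))

theorem exists_permIncl_eq {k : ℕ} {g : Equiv.Perm (Fin (k + 1))}
    (hg : g (Fin.last k) = Fin.last k) : ∃ a, permIncl k a = g := by
  have hg' : g⁻¹ (Fin.last k) = Fin.last k := Equiv.Perm.inv_eq_iff_eq.mpr hg.symm
  refine ⟨⟨fun x => (g x.castSucc).castPred (castSucc_apply_ne_last hg x),
    fun x => (g⁻¹ x.castSucc).castPred (castSucc_apply_ne_last hg' x),
    fun x => by simp, fun x => by simp⟩, ?_⟩
  ext x : 1
  induction x using Fin.lastCases with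
  | last => rw [permIncl_last, hg]
  | cast x => simp

theorem lastSwap_apply_last (m : ℕ) :
    lastSwap m (Fin.last (m + 1)) = (Fin.last m).castSucc :=
  Equiv.swap_apply_right _ _

theorem lastSwap_mul_self (m : ℕ) : lastSwap m * lastSwap m = 1 :=
  Equiv.swap_mul_self _ _

/-- `S_{n-1}` centralizes `s_n`. -/
theorem permIncl_permIncl_mul_lastSwap {m : ℕ} (c : Equiv.Perm (Fin m)) :
    permIncl (m + 1) (permIncl m c) * lastSwap m =
      lastSwap m * permIncl (m + 1) (permIncl m c) := by
  rw [lastSwap, Equiv.mul_swap_eq_swap_mul]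
  simp

/-- Permutations outside `S_n` lie in the double coset `S_n s_n S_n`. -/
theorem exists_eq_mul_lastSwap_mul {m : ℕ} {g : Equiv.Perm (Fin (m + 2))}
    (hg : g (Fin.last (m + 1)) ≠ Fin.last (m + 1)) :
    ∃ a b, g = permIncl (m + 1) a * lastSwap m * permIncl (m + 1) b := by
  obtain ⟨p, hp⟩ := Fin.exists_castSucc_eq.mpr hg
  have h : (lastSwap m * permIncl (m + 1) (Equiv.swap p (Fin.last m)) * g) (Fin.last (m + 1)) =
      Fin.last (m + 1) := by
    simp [← hp, lastSwap]
  obtain ⟨b, hb⟩ := exists_permIncl_eq h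
  refine ⟨(Equiv.swap p (Fin.last m))⁻¹, b, ?_⟩
  rw [hb, map_inv, mul_assoc, mul_assoc, ← mul_assoc (lastSwap m), lastSwap_mul_self]
  simp

theorem mul_lastSwap_mul_apply_last_ne {m : ℕ} (a b : Equiv.Perm (Fin (m + 1))) :
    (permIncl (m + 1) a * lastSwap m * permIncl (m + 1) b) (Fin.last (m + 1)) ≠
      Fin.last (m + 1) := by
  simp [lastSwap_apply_last, Fin.castSucc_ne_last]

/-- The fibres of `(a, b) ↦ a s_n b` are orbits of `S_{n-1}`. -/
theorem exists_of_mul_lastSwap_mul_eq {m : ℕ} {a b a' b' : Equiv.Perm (Fin (m + 1))}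
    (h : permIncl (m + 1) a * lastSwap m * permIncl (m + 1) b =
      permIncl (m + 1) a' * lastSwap m * permIncl (m + 1) b') :
    ∃ c, a' = a * permIncl m c ∧ b = permIncl m c * b' := by
  have key : permIncl (m + 1) (a⁻¹ * a') * lastSwap m =
      lastSwap m * permIncl (m + 1) (b * b'⁻¹) := by
    rw [map_mul, map_mul, map_inv, map_inv, mul_assoc, inv_mul_eq_iff_eq_mul, ← mul_assoc,
      ← mul_assoc, eq_mul_inv_iff_mul_eq, h]
  have hfix : (a⁻¹ * a') (Fin.last m) = Fin.last m := by
    have := congrArg (fun g : Equiv.Perm _ => g (Fin.last (m + 1))) key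
    simpa only [Equiv.Perm.mul_apply, lastSwap_apply_last, permIncl_castSucc, permIncl_last,
      Fin.castSucc_inj] using this
  obtain ⟨c, hc⟩ := exists_permIncl_eq hfix
  rw [← hc, permIncl_permIncl_mul_lastSwap] at key
  have hb := permIncl_injective _ (mul_left_cancel key)
  exact ⟨c, by rw [hc, mul_inv_cancel_left], by rw [hb, inv_mul_cancel_right]⟩

theorem gaIncl_of {k : ℕ} (a : Equiv.Perm (Fin k)) :
    gaIncl k (MonoidAlgebra.of ℂ _ a) = MonoidAlgebra.of ℂ _ (permIncl k a) := by
  simp [gaIncl]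

theorem swapEl_eq (m : ℕ) : swapEl m = MonoidAlgebra.of ℂ _ (lastSwap m) := rfl

theorem symPsi_apply_tmul {m : ℕ} (a x y : GA (m + 1)) :
    symPsi m (a, x ⊗ₜ[ℂ] y) =
      gaIncl (m + 1) a + gaIncl (m + 1) x * swapEl m * gaIncl (m + 1) y := rfl

theorem symPsi_of_inl {m : ℕ} (a : Equiv.Perm (Fin (m + 1))) :
    symPsi m (MonoidAlgebra.of ℂ _ a, 0) = MonoidAlgebra.of ℂ _ (permIncl (m + 1) a) := by
  rw [← gaIncl_of]
  simp [symPsi]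

theorem symPsi_of_tmul_of {m : ℕ} (a b : Equiv.Perm (Fin (m + 1))) :
    symPsi m (0, MonoidAlgebra.of ℂ _ a ⊗ₜ[ℂ] MonoidAlgebra.of ℂ _ b) =
      MonoidAlgebra.of ℂ _ (permIncl (m + 1) a * lastSwap m * permIncl (m + 1) b) := by
  rw [symPsi_apply_tmul, map_zero, zero_add, swapEl_eq, gaIncl_of, gaIncl_of, map_mul, map_mul]

theorem commute_gaIncl_gaIncl_swapEl {m : ℕ} (c : GA m) :
    Commute (gaIncl (m + 1) (gaIncl m c)) (swapEl m) := by
  induction c using MonoidAlgebra.induction_on with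
  | of c =>
    rw [gaIncl_of, gaIncl_of, swapEl_eq, commute_iff_eq, ← map_mul,
      permIncl_permIncl_mul_lastSwap, map_mul]
  | add x y hx hy => simpa only [map_add] using hx.add_left hy
  | smul r x hx => simpa only [map_smul] using hx.smul_left r

theorem mkQ_of_tmul_of_eq {m : ℕ} {a b a' b' : Equiv.Perm (Fin (m + 1))}
    (h : permIncl (m + 1) a * lastSwap m * permIncl (m + 1) b =
      permIncl (m + 1) a' * lastSwap m * permIncl (m + 1) b') :
    (balancedSubS m).mkQ (MonoidAlgebra.of ℂ _ a ⊗ₜ[ℂ] MonoidAlgebra.of ℂ _ b) =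
      (balancedSubS m).mkQ (MonoidAlgebra.of ℂ _ a' ⊗ₜ[ℂ] MonoidAlgebra.of ℂ _ b') := by
  obtain ⟨c, rfl, rfl⟩ := exists_of_mul_lastSwap_mul_eq h
  refine ((Submodule.Quotient.eq (balancedSubS m)).mpr ?_).symm
  refine Submodule.subset_span
    ⟨MonoidAlgebra.of ℂ _ a, MonoidAlgebra.of ℂ _ b', MonoidAlgebra.of ℂ _ c, ?_⟩
  rw [gaIncl_of, map_mul, map_mul]

/-- `(a, x ⊗ y) ↦ (a, [x ⊗ y])`, the projection to `ℂ[S_n] ⊕ (ℂ[S_n] ⊗_{ℂ[S_{n-1}]} ℂ[S_n])`. -/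
noncomputable def balancedProj (m : ℕ) :
    GA (m + 1) × (GA (m + 1) ⊗[ℂ] GA (m + 1)) →ₗ[ℂ]
      GA (m + 1) × ((GA (m + 1) ⊗[ℂ] GA (m + 1)) ⧸ balancedSubS m) :=
  LinearMap.prodMap LinearMap.id (balancedSubS m).mkQ

theorem exists_comp_symPsi_eq_balancedProj (m : ℕ) :
    ∃ θ : GA (m + 2) →ₗ[ℂ] GA (m + 1) × ((GA (m + 1) ⊗[ℂ] GA (m + 1)) ⧸ balancedSubS m),
      θ ∘ₗ symPsi m = balancedProj m := by
  have hval : ∀ g : Equiv.Perm (Fin (m + 2)),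
      ∃ v : GA (m + 1) × ((GA (m + 1) ⊗[ℂ] GA (m + 1)) ⧸ balancedSubS m),
        (∀ a, permIncl (m + 1) a = g → v = (MonoidAlgebra.of ℂ _ a, 0)) ∧
        ∀ a b, permIncl (m + 1) a * lastSwap m * permIncl (m + 1) b = g →
          v = (0, (balancedSubS m).mkQ (MonoidAlgebra.of ℂ _ a ⊗ₜ[ℂ] MonoidAlgebra.of ℂ _ b)) := by
    intro g
    by_cases hg : g (Fin.last (m + 1)) = Fin.last (m + 1)
    · obtain ⟨a, rfl⟩ := exists_permIncl_eq hg
      refine ⟨(MonoidAlgebra.of ℂ _ a, 0), fun a' h => ?_, fun x y h => ?_⟩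
      · rw [permIncl_injective _ h]
      · exact absurd (h ▸ hg) (mul_lastSwap_mul_apply_last_ne x y)
    · obtain ⟨a, b, rfl⟩ := exists_eq_mul_lastSwap_mul hg
      refine ⟨(0, (balancedSubS m).mkQ (MonoidAlgebra.of ℂ _ a ⊗ₜ[ℂ] MonoidAlgebra.of ℂ _ b)),
        fun x h => ?_, fun x y h => ?_⟩
      · exact absurd (h ▸ permIncl_last x) hg
      · rw [mkQ_of_tmul_of_eq h]
  choose v hv hv' using hval
  let θ := (MonoidAlgebra.basis (Equiv.Perm (Fin (m + 2))) ℂ).constr ℂ v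
  have hθ (g) : θ (MonoidAlgebra.of ℂ _ g) = v g := by
    rw [← (MonoidAlgebra.basis (Equiv.Perm (Fin (m + 2))) ℂ).constr_basis ℂ v g,
      MonoidAlgebra.basis_apply, MonoidAlgebra.of_apply]
  refine ⟨θ, LinearMap.prod_ext ?_ (TensorProduct.ext ?_)⟩
  · refine (MonoidAlgebra.basis _ ℂ).ext fun a => ?_
    have := hθ (permIncl (m + 1) a)
    rw [← symPsi_of_inl, hv _ a rfl] at this
    simpa [balancedProj] using this
  · refine (MonoidAlgebra.basis _ ℂ).ext fun a => (MonoidAlgebra.basis _ ℂ).ext fun b => ?_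
    have := hθ (permIncl (m + 1) a * lastSwap m * permIncl (m + 1) b)
    rw [← symPsi_of_tmul_of, hv' _ a b rfl] at this
    simpa [balancedProj] using this

theorem symPsi_surjective (m : ℕ) : Function.Surjective (symPsi m) := by
  rw [← LinearMap.range_eq_top, eq_top_iff]
  intro z _
  induction z using MonoidAlgebra.induction_on with
  | of g =>
    by_cases hg : g (Fin.last (m + 1)) = Fin.last (m + 1)
    · obtain ⟨a, rfl⟩ := exists_permIncl_eq hg
      exact ⟨_, symPsi_of_inl a⟩
    · obtain ⟨a, b, rfl⟩ := exists_eq_mul_lastSwap_mul hg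
      exact ⟨_, symPsi_of_tmul_of a b⟩
  | add x y hx hy => exact add_mem (hx trivial) (hy trivial)
  | smul r x hx => exact Submodule.smul_mem _ r (hx trivial)

theorem balancedSubS_le_ker (m : ℕ) :
    balancedSubS m ≤ LinearMap.ker (TensorProduct.lift (midMulS m)) := by
  refine Submodule.span_le.mpr ?_
  rintro _ ⟨x, y, c, rfl⟩
  simp only [SetLike.mem_coe, LinearMap.mem_ker, map_sub, TensorProduct.lift.tmul, midMulS,
    LinearMap.mk₂_apply, map_mul, sub_eq_zero]
  simp only [mul_assoc]
  rw [← mul_assoc (swapEl m), ← (commute_gaIncl_gaIncl_swapEl c).eq, mul_assoc]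

/-- for every `n ≥ 1` (here `n = m+1`) there is an isomorphism of
`(ℂ[S_n], ℂ[S_n])`-bimodules
`ℂ[S_{n+1}] ≅ ℂ[S_n] ⊕ (ℂ[S_n] ⊗_{ℂ[S_{n−1}]} ℂ[S_n])`, with first component the
inclusion and second component `x ⊗ y ↦ x s_n y`.  Concretely: the map
`(a, x ⊗ y) ↦ a + x s_n y` is surjective onto `ℂ[S_{n+1}]` and its kernel is exactly
`0 ⊕ S`, where `S` is the span of the `ℂ[S_{n−1}]`-balanced differences. -/
theorem symmetric_group_bimodule_decomposition (m : ℕ) :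
    Function.Surjective (symPsi m)
    ∧ LinearMap.ker (symPsi m) = Submodule.prod ⊥ (balancedSubS m) := by
  refine ⟨symPsi_surjective m, le_antisymm ?_ ?_⟩
  · obtain ⟨θ, hθ⟩ := exists_comp_symPsi_eq_balancedProj m
    calc LinearMap.ker (symPsi m) ≤ LinearMap.ker (θ ∘ₗ symPsi m) := LinearMap.ker_le_ker_comp _ _
      _ = Submodule.prod ⊥ (balancedSubS m) := by
        rw [hθ, balancedProj, LinearMap.ker_prodMap, LinearMap.ker_id, Submodule.ker_mkQ]
  · rintro ⟨a, z⟩ ⟨rfl, hz⟩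
    simpa [symPsi] using balancedSubS_le_ker m hz
end
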